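/- Given ν>0 there exist τ_ν>0 and σ_ν>2τ_ν such that for every optimal trajectory on [0,T] steering X₀=(0,0,π/2,0) to X₁=(x₁,y₁,θ₁,0) with |(x₁,y₁)| ≥ 8√π and final time T>σ_ν, equipped with PMP adjoint data (ρ, φ̂, p₃, p₄), the function Z(t)=(θ(t),κ(t),p₃(t),p₄(t)) satisfies |Z(t)−(α,0,0,0)|<ν for all t ∈ [τ_ν, T−τ_ν], where (x₁,y₁)=|(x₁,y₁)|(cos α, sin α) with α ∈ [0,2π) and the difference θ(t)−α in the first component is taken modulo 2π with values in [−π,π]. -/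

import Mathlib

open MeasureTheory Real Set

noncomputable section

/-- Distance between two angles, computed modulo `2π`, with values in `[0, π]`. -/
def angleDist (a b : ℝ) : ℝ := ‖((a - b : ℝ) : Real.Angle)‖

/-- Hypothesis (H1): `φ` and `ψ` are nonnegative, `C²`, even, nondecreasing on `[0,∞)`,
and vanish at `0`. -/
def H1 (φ ψ : ℝ → ℝ) : Prop :=
  (∀ r, 0 ≤ φ r) ∧ (∀ r, 0 ≤ ψ r) ∧
  ContDiff ℝ 2 φ ∧ ContDiff ℝ 2 ψ ∧
  (∀ r, φ (-r) = φ r) ∧ (∀ r, ψ (-r) = ψ r) ∧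
  MonotoneOn φ (Set.Ici 0) ∧ MonotoneOn ψ (Set.Ici 0) ∧
  φ 0 = 0 ∧ ψ 0 = 0

/-- Hypothesis (H2): `ψ` is strictly convex with `ψ''(0) > 0`. -/
def H2 (ψ : ℝ → ℝ) : Prop :=
  StrictConvexOn ℝ Set.univ ψ ∧ 0 < iteratedDeriv 2 ψ 0

/-- Hypothesis (H3): superlinear growth `ψ(r) ≥ C₀ |r|^p` for `|r| ≥ R₀`. -/
def H3 (ψ : ℝ → ℝ) (p C₀ R₀ : ℝ) : Prop :=
  1 < p ∧ 0 < C₀ ∧ 0 < R₀ ∧ ∀ r : ℝ, R₀ ≤ |r| → C₀ * |r| ^ p ≤ ψ r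

/-- An admissible trajectory of the control system `x' = cos θ`, `y' = sin θ`,
`θ' = κ`, `κ' = u` on `[0, T]` steering `W₀` to `W₁`, with control `u ∈ L^p`;
the final angle is prescribed modulo `2π`. -/
def Connects (p : ℝ) (x y θ κ u : ℝ → ℝ) (T : ℝ)
    (W₀ W₁ : ℝ × ℝ × ℝ × ℝ) : Prop :=
  0 < T ∧ Measurable u ∧
  IntegrableOn (fun t => |u t| ^ p) (Set.Icc 0 T) ∧
  x 0 = W₀.1 ∧ y 0 = W₀.2.1 ∧ θ 0 = W₀.2.2.1 ∧ κ 0 = W₀.2.2.2 ∧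
  (∀ t ∈ Set.Icc (0:ℝ) T, x t = x 0 + ∫ s in (0:ℝ)..t, Real.cos (θ s)) ∧
  (∀ t ∈ Set.Icc (0:ℝ) T, y t = y 0 + ∫ s in (0:ℝ)..t, Real.sin (θ s)) ∧
  (∀ t ∈ Set.Icc (0:ℝ) T, θ t = θ 0 + ∫ s in (0:ℝ)..t, κ s) ∧
  (∀ t ∈ Set.Icc (0:ℝ) T, κ t = κ 0 + ∫ s in (0:ℝ)..t, u s) ∧
  x T = W₁.1 ∧ y T = W₁.2.1 ∧ (∃ k : ℤ, θ T = W₁.2.2.1 + 2 * π * (k : ℝ)) ∧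
  κ T = W₁.2.2.2

/-- The cost `C(u,T) = ∫₀ᵀ (1 + φ(κ(t)) + ψ(u(t))) dt`. -/
def cost (φ ψ κ u : ℝ → ℝ) (T : ℝ) : ℝ :=
  ∫ t in (0:ℝ)..T, (1 + φ (κ t) + ψ (u t))

/-- Optimality: the trajectory is admissible and minimizes the cost among all
admissible trajectories steering `W₀` to `W₁`, over all final times. -/
def IsOptimal (φ ψ : ℝ → ℝ) (p : ℝ) (x y θ κ u : ℝ → ℝ) (T : ℝ)
    (W₀ W₁ : ℝ × ℝ × ℝ × ℝ) : Prop :=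
  Connects p x y θ κ u T W₀ W₁ ∧
  ∀ x' y' θ' κ' u' : ℝ → ℝ, ∀ T' : ℝ, Connects p x' y' θ' κ' u' T' W₀ W₁ →
    cost φ ψ κ u T ≤ cost φ ψ κ' u' T'

/-- The initial point `X₀ = (0, 0, π/2, 0)`. -/
def Xinit : ℝ × ℝ × ℝ × ℝ := (0, 0, π/2, 0)

/-- The constant `C_{φ,ψ} = 8√π (2 + ψ(1) + sup_{s∈[0,√(5π)]} φ(s))`. -/
def Cconst (φ ψ : ℝ → ℝ) : ℝ :=
  8 * Real.sqrt π * (2 + ψ 1 + sSup (φ '' Set.Icc 0 (Real.sqrt (5*π))))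

/-- PMP adjoint data `(ρ, φ̂, p₃, p₄)` along a trajectory. -/
def PMPData (φ ψ : ℝ → ℝ) (θ κ u : ℝ → ℝ) (T ρ φh : ℝ) (p₃ p₄ : ℝ → ℝ) : Prop :=
  0 < ρ ∧ φh ∈ Set.Ico 0 (2*π) ∧
  (∀ t ∈ Set.Icc (0:ℝ) T, p₃ t = p₃ 0 + ∫ s in (0:ℝ)..t, ρ * Real.sin (θ s - φh)) ∧
  (∀ t ∈ Set.Icc (0:ℝ) T, p₄ t = p₄ 0 + ∫ s in (0:ℝ)..t, (-(p₃ s) + deriv φ (κ s))) ∧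
  (∀ᵐ t ∂(volume.restrict (Set.Icc (0:ℝ) T)), deriv ψ (u t) = p₄ t) ∧
  (∀ᵐ t ∂(volume.restrict (Set.Icc (0:ℝ) T)),
    ρ * Real.cos (θ t - φh) + p₃ t * κ t + p₄ t * u t
      - (1 + φ (κ t) + ψ (u t)) = 0)

/-- `f` is an indefinite integral of the integrable function `g` on `[0, T]`. -/
def IsPrimitive (f g : ℝ → ℝ) (T : ℝ) : Prop :=
  IntervalIntegrable g volume 0 T ∧ ∀ t ∈ Icc (0:ℝ) T, f t = f 0 + ∫ s in (0:ℝ)..t, g s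

lemma intervalIntegrable_mono_Icc {g : ℝ → ℝ} {T a b : ℝ}
    (h : IntervalIntegrable g volume 0 T) (ha : a ∈ Icc 0 T) (hb : b ∈ Icc 0 T) :
    IntervalIntegrable g volume a b := by
  have hT : (0:ℝ) ≤ T := ha.1.trans ha.2
  refine h.mono_set ?_
  rw [uIcc_of_le hT]
  exact uIcc_subset_Icc ha hb

lemma intervalIntegrable_shift {g : ℝ → ℝ} {T a S : ℝ}
    (h : IntervalIntegrable g volume 0 T) (ha : 0 ≤ a) (hS : 0 ≤ S) (haS : a + S ≤ T) :
    IntervalIntegrable (fun s => g (a + s)) volume 0 S := by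
  have h1 := intervalIntegrable_mono_Icc (a := a) (b := a + S) h ⟨ha, by linarith⟩
    ⟨by linarith, haS⟩
  simpa using h1.comp_add_left a

namespace IsPrimitive

variable {f g : ℝ → ℝ} {T a b S : ℝ}

lemma sub_eq (h : IsPrimitive f g T) (ha : a ∈ Icc 0 T) (hb : b ∈ Icc 0 T) :
    f b - f a = ∫ s in a..b, g s := by
  have h0 : (0:ℝ) ∈ Icc 0 T := ⟨le_rfl, ha.1.trans ha.2⟩
  rw [h.2 a ha, h.2 b hb, ← intervalIntegral.integral_interval_sub_left
    (intervalIntegrable_mono_Icc h.1 h0 hb) (intervalIntegrable_mono_Icc h.1 h0 ha)]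
  ring

lemma continuousOn (h : IsPrimitive f g T) (hT : 0 ≤ T) : ContinuousOn f (Icc 0 T) := by
  have h1 := (intervalIntegrable_iff_integrableOn_Icc_of_le hT).1 h.1
  rw [← uIcc_of_le hT] at h1
  have h2 := intervalIntegral.continuousOn_primitive_interval h1
  rw [uIcc_of_le hT] at h2
  exact (continuousOn_const.add h2).congr h.2

lemma restrict (h : IsPrimitive f g T) (ha : 0 ≤ a) (hS : 0 ≤ S) (haS : a + S ≤ T) :
    IsPrimitive (fun s => f (a + s)) (fun s => g (a + s)) S := by
  refine ⟨intervalIntegrable_shift h.1 ha hS haS, fun t ht => ?_⟩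
  have h1 := h.sub_eq (a := a) (b := a + t) ⟨ha, by linarith⟩
    ⟨by linarith [ht.1], by linarith [ht.2]⟩
  have h2 := intervalIntegral.integral_comp_add_left (a := 0) (b := t) g a
  simp only [add_zero] at h2 ⊢
  rw [h2, ← h1]
  ring

end IsPrimitive

lemma isPrimitive_of_integral {g : ℝ → ℝ} {T : ℝ} (c : ℝ) (h : IntervalIntegrable g volume 0 T) :
    IsPrimitive (fun t => c + ∫ s in (0:ℝ)..t, g s) g T :=
  ⟨h, fun t _ => by simp⟩

lemma isPrimitive_of_hasDerivAt {f g : ℝ → ℝ} (T : ℝ) (h : ∀ t, HasDerivAt f (g t) t)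
    (hg : Continuous g) : IsPrimitive f g T := by
  refine ⟨hg.intervalIntegrable _ _, fun t _ => ?_⟩
  rw [intervalIntegral.integral_eq_sub_of_hasDerivAt (fun s _ => h s) (hg.intervalIntegrable _ _)]
  ring

/-- The function equal to `f` up to time `T` and to `g`, started afresh, afterwards. -/
def concat (T : ℝ) (f g : ℝ → ℝ) : ℝ → ℝ := fun t => if t ≤ T then f t else g (t - T)

section Concat

variable {f g f' g' : ℝ → ℝ} {T S : ℝ}

lemma concat_left {t : ℝ} (h : t ≤ T) : concat T f g t = f t := if_pos h

lemma concat_right {t : ℝ} (h : T < t) : concat T f g t = g (t - T) := if_neg (not_le.2 h)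

lemma comp_concat (F : ℝ → ℝ) :
    (fun t => F (concat T f g t)) = concat T (fun t => F (f t)) (fun t => F (g t)) := by
  funext t
  unfold concat
  split_ifs <;> rfl

lemma integral_concat_left {t : ℝ} (ht0 : 0 ≤ t) (ht : t ≤ T) :
    ∫ s in (0:ℝ)..t, concat T f g s = ∫ s in (0:ℝ)..t, f s :=
  intervalIntegral.integral_congr fun s hs => by
    rw [uIcc_of_le ht0] at hs
    exact concat_left (hs.2.trans ht)

lemma intervalIntegrable_concat_right {t : ℝ} (ht : 0 ≤ t)
    (h : IntervalIntegrable g volume 0 t) :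
    IntervalIntegrable (concat T f g) volume T (T + t) ∧
      ∫ s in T..(T + t), concat T f g s = ∫ s in (0:ℝ)..t, g s := by
  have h1 := h.comp_sub_right T
  rw [zero_add, add_comm t T] at h1
  have h2 : EqOn (fun s => g (s - T)) (concat T f g) (uIoc T (T + t)) := fun s hs => by
    rw [uIoc_of_le (by linarith)] at hs
    exact (concat_right hs.1).symm
  refine ⟨h1.congr h2, ?_⟩
  rw [← intervalIntegral.integral_congr_ae (Filter.Eventually.of_forall h2),
    intervalIntegral.integral_comp_sub_right]
  simp

lemma intervalIntegrable_concat (hT : 0 ≤ T) (hS : 0 ≤ S) (hf : IntervalIntegrable f volume 0 T)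
    (hg : IntervalIntegrable g volume 0 S) :
    IntervalIntegrable (concat T f g) volume 0 (T + S) := by
  refine IntervalIntegrable.trans (b := T) (hf.congr fun s hs => ?_)
    (intervalIntegrable_concat_right hS hg).1
  rw [uIoc_of_le hT] at hs
  exact (concat_left hs.2).symm

lemma integral_concat {t : ℝ} (hT : 0 ≤ T) (ht : 0 ≤ t) (hf : IntervalIntegrable f volume 0 T)
    (hg : IntervalIntegrable g volume 0 t) :
    ∫ s in (0:ℝ)..(T + t), concat T f g s = (∫ s in (0:ℝ)..T, f s) + ∫ s in (0:ℝ)..t, g s := by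
  have h1 := intervalIntegrable_concat_right (f := f) (T := T) ht hg
  rw [← intervalIntegral.integral_add_adjacent_intervals (b := T) _ h1.1,
    h1.2, integral_concat_left hT le_rfl]
  refine hf.congr fun s hs => ?_
  rw [uIoc_of_le hT] at hs
  exact (concat_left hs.2).symm

lemma concat_end (hS : 0 < S) : concat T f g (T + S) = g S := by
  rw [concat_right (by linarith)]
  simp

lemma IsPrimitive.concat (hT : 0 ≤ T) (hS : 0 ≤ S) (hf : IsPrimitive f f' T)
    (hg : IsPrimitive g g' S) (hfg : f T = g 0) :
    IsPrimitive (concat T f g) (concat T f' g') (T + S) := by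
  refine ⟨intervalIntegrable_concat hT hS hf.1 hg.1, fun t ht => ?_⟩
  rw [concat_left (f := f) hT]
  rcases le_or_gt t T with h | h
  · rw [concat_left h, integral_concat_left ht.1 h]
    exact hf.2 t ⟨ht.1, h⟩
  · obtain ⟨s, rfl⟩ : ∃ s, t = T + s := ⟨t - T, by ring⟩
    have hs : s ∈ Icc 0 S := ⟨by linarith, by linarith [ht.2]⟩
    rw [integral_concat hT hs.1 hf.1
      (intervalIntegrable_mono_Icc hg.1 ⟨le_rfl, hS⟩ hs), concat_end (by linarith),
      hg.2 s hs, ← hfg, hf.2 T ⟨hT, le_rfl⟩]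
    ring

end Concat

/-- A trajectory of the control system on `[0, T]` with control in `L^p` and integrable
running cost. -/
structure Arc (φ ψ : ℝ → ℝ) (p : ℝ) (x y θ κ u : ℝ → ℝ) (T : ℝ) : Prop where
  pos : 0 < T
  meas : Measurable u
  pow : IntervalIntegrable (fun t => |u t| ^ p) volume 0 T
  x_prim : IsPrimitive x (fun t => cos (θ t)) T
  y_prim : IsPrimitive y (fun t => sin (θ t)) T
  θ_prim : IsPrimitive θ κ T
  κ_prim : IsPrimitive κ u T
  cost_int : IntervalIntegrable (fun t => 1 + φ (κ t) + ψ (u t)) volume 0 T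

namespace Arc

variable {φ ψ : ℝ → ℝ} {p : ℝ} {x y θ κ u x' y' θ' κ' u' : ℝ → ℝ} {T S a : ℝ}

lemma restrict (h : Arc φ ψ p x y θ κ u T) (ha : 0 ≤ a) (hS : 0 < S) (haS : a + S ≤ T) :
    Arc φ ψ p (fun s => x (a + s)) (fun s => y (a + s)) (fun s => θ (a + s))
      (fun s => κ (a + s)) (fun s => u (a + s)) S where
  pos := hS
  meas := h.meas.comp (measurable_const_add a)
  pow := intervalIntegrable_shift h.pow ha hS.le haS
  x_prim := h.x_prim.restrict ha hS.le haS
  y_prim := h.y_prim.restrict ha hS.le haS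
  θ_prim := h.θ_prim.restrict ha hS.le haS
  κ_prim := h.κ_prim.restrict ha hS.le haS
  cost_int := intervalIntegrable_shift h.cost_int ha hS.le haS

lemma shift_angle (h : Arc φ ψ p x y θ κ u T) (k : ℤ) :
    Arc φ ψ p x y (fun t => θ t + k * (2 * π)) κ u T where
  pos := h.pos
  meas := h.meas
  pow := h.pow
  x_prim := by simpa using h.x_prim
  y_prim := by simpa using h.y_prim
  θ_prim := ⟨h.θ_prim.1, fun t ht => by have := h.θ_prim.2 t ht; linarith⟩
  κ_prim := h.κ_prim
  cost_int := h.cost_int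

lemma concat (h : Arc φ ψ p x y θ κ u T) (h' : Arc φ ψ p x' y' θ' κ' u' S)
    (hx : x T = x' 0) (hy : y T = y' 0) (hθ : θ T = θ' 0) (hκ : κ T = κ' 0) :
    Arc φ ψ p (concat T x x') (concat T y y') (concat T θ θ') (concat T κ κ') (concat T u u')
      (T + S) where
  pos := add_pos h.pos h'.pos
  meas := Measurable.ite measurableSet_Iic h.meas (h'.meas.comp (measurable_sub_const T))
  pow := by
    rw [comp_concat fun v => |v| ^ p]
    exact intervalIntegrable_concat h.pos.le h'.pos.le h.pow h'.pow
  x_prim := by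
    rw [comp_concat cos]
    exact h.x_prim.concat h.pos.le h'.pos.le h'.x_prim hx
  y_prim := by
    rw [comp_concat sin]
    exact h.y_prim.concat h.pos.le h'.pos.le h'.y_prim hy
  θ_prim := h.θ_prim.concat h.pos.le h'.pos.le h'.θ_prim hθ
  κ_prim := h.κ_prim.concat h.pos.le h'.pos.le h'.κ_prim hκ
  cost_int := by
    have : (fun t => 1 + φ (_root_.concat T κ κ' t) + ψ (_root_.concat T u u' t)) =
        _root_.concat T (fun t => 1 + φ (κ t) + ψ (u t)) (fun t => 1 + φ (κ' t) + ψ (u' t)) := by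
      funext t
      unfold _root_.concat
      split_ifs <;> rfl
    rw [this]
    exact intervalIntegrable_concat h.pos.le h'.pos.le h.cost_int h'.cost_int

lemma cost_concat (h : Arc φ ψ p x y θ κ u T) (h' : Arc φ ψ p x' y' θ' κ' u' S) :
    cost φ ψ (_root_.concat T κ κ') (_root_.concat T u u') (T + S) =
      cost φ ψ κ u T + cost φ ψ κ' u' S := by
  unfold cost
  rw [← integral_concat h.pos.le h'.pos.le h.cost_int h'.cost_int]
  congr 1
  funext t
  unfold _root_.concat
  split_ifs <;> rfl

lemma connects (h : Arc φ ψ p x y θ κ u T) {W₀ W₁ : ℝ × ℝ × ℝ × ℝ}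
    (h₀ : (x 0, y 0, θ 0, κ 0) = W₀) {k : ℤ}
    (h₁ : (x T, y T, θ T - 2 * π * k, κ T) = W₁) : Connects p x y θ κ u T W₀ W₁ := by
  subst h₀ h₁
  exact ⟨h.pos, h.meas, (intervalIntegrable_iff_integrableOn_Icc_of_le h.pos.le).1 h.pow,
    rfl, rfl, rfl, rfl, h.x_prim.2, h.y_prim.2, h.θ_prim.2, h.κ_prim.2, rfl, rfl,
    ⟨k, by ring⟩, rfl⟩

lemma of_hasDerivAt (hφ : Continuous φ) (hψ : Continuous ψ) (hp : 0 ≤ p)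
    (hθ : ∀ t, HasDerivAt θ (κ t) t) (hκ : ∀ t, HasDerivAt κ (u t) t) (hu : Continuous u)
    (hT : 0 < T) (x₀ y₀ : ℝ) :
    Arc φ ψ p (fun t => x₀ + ∫ s in (0:ℝ)..t, cos (θ s))
      (fun t => y₀ + ∫ s in (0:ℝ)..t, sin (θ s)) θ κ u T := by
  have hθc : Continuous θ := continuous_iff_continuousAt.2 fun t => (hθ t).continuousAt
  have hκc : Continuous κ := continuous_iff_continuousAt.2 fun t => (hκ t).continuousAt
  refine ⟨hT, hu.measurable, ?_, isPrimitive_of_integral _ ?_, isPrimitive_of_integral _ ?_,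
    isPrimitive_of_hasDerivAt T hθ hκc, isPrimitive_of_hasDerivAt T hκ hu, ?_⟩
  · exact (hu.abs.rpow_const fun _ => Or.inr hp).intervalIntegrable _ _
  · exact (by fun_prop : Continuous fun t => cos (θ t)).intervalIntegrable _ _
  · exact (by fun_prop : Continuous fun t => sin (θ t)).intervalIntegrable _ _
  · exact (by fun_prop : Continuous fun t => 1 + φ (κ t) + ψ (u t)).intervalIntegrable _ _

end Arc

namespace IsOptimal

variable {φ ψ : ℝ → ℝ} {p : ℝ} {x y θ κ u x' y' θ' κ' u' : ℝ → ℝ} {T S S' a : ℝ}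
  {W₀ W₁ : ℝ × ℝ × ℝ × ℝ}

/-- Replacing the part of an optimal trajectory between times `a` and `a + S` does not lower
the cost. -/
lemma cost_le_of_subarc (hopt : IsOptimal φ ψ p x y θ κ u T W₀ W₁)
    (h : Arc φ ψ p x y θ κ u T) (ha : 0 < a) (hS : 0 < S) (haS : a + S < T)
    (h' : Arc φ ψ p x' y' θ' κ' u' S') (hx₀ : x' 0 = x a) (hy₀ : y' 0 = y a)
    (hθ₀ : θ' 0 = θ a) (hκ₀ : κ' 0 = κ a) (hx₁ : x' S' = x (a + S)) (hy₁ : y' S' = y (a + S))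
    {m : ℤ} (hθ₁ : θ' S' = θ (a + S) + m * (2 * π)) (hκ₁ : κ' S' = κ (a + S)) :
    cost φ ψ (fun s => κ (a + s)) (fun s => u (a + s)) S ≤ cost φ ψ κ' u' S' := by
  have hR : 0 < T - (a + S) := by linarith
  have A1 : Arc φ ψ p x y θ κ u a := by
    simpa using h.restrict (a := 0) (S := a) le_rfl ha (by linarith)
  have A3 := (h.restrict (a := a + S) (S := T - (a + S)) (by linarith) hR
    (by linarith)).shift_angle m
  have A12 := A1.concat h' hx₀.symm hy₀.symm hθ₀.symm hκ₀.symm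
  have A123 := A12.concat A3
    (by rw [concat_end h'.pos, add_zero, hx₁]) (by rw [concat_end h'.pos, add_zero, hy₁])
    (by rw [concat_end h'.pos, add_zero, hθ₁]) (by rw [concat_end h'.pos, add_zero, hκ₁])
  obtain ⟨hC, hmin⟩ := hopt
  obtain ⟨-, -, -, b1, b2, b3, b4, -, -, -, -, e1, e2, ⟨k, e3⟩, e4⟩ := hC
  have hTe : a + S + (T - (a + S)) = T := by ring
  have hle := hmin _ _ _ _ _ _ (A123.connects (W₀ := W₀) (W₁ := W₁) (k := k + m) (by
      have h0 : (0:ℝ) ≤ a + S' := by linarith [h'.pos]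
      simp only [concat_left h0, concat_left ha.le, b1, b2, b3, b4]) (by
      simp only [concat_end hR, hTe, e1, e2, e3, e4]
      refine Prod.ext rfl (Prod.ext rfl (Prod.ext ?_ rfl))
      push_cast
      ring))
  rw [A12.cost_concat A3, A1.cost_concat h'] at hle
  have hcost : cost φ ψ κ u T = cost φ ψ κ u a +
      cost φ ψ (fun s => κ (a + s)) (fun s => u (a + s)) S +
      cost φ ψ (fun s => κ (a + S + s)) (fun s => u (a + S + s)) (T - (a + S)) := by
    unfold cost
    have m1 : (0:ℝ) ∈ Icc 0 T := ⟨le_rfl, h.pos.le⟩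
    have m2 : a ∈ Icc 0 T := ⟨ha.le, by linarith⟩
    have m3 : a + S ∈ Icc 0 T := ⟨by linarith, haS.le⟩
    have m4 : T ∈ Icc 0 T := ⟨h.pos.le, le_rfl⟩
    have i1 := intervalIntegral.integral_comp_add_left (a := 0) (b := S)
      (fun t => 1 + φ (κ t) + ψ (u t)) a
    have i2 := intervalIntegral.integral_comp_add_left (a := 0) (b := T - (a + S))
      (fun t => 1 + φ (κ t) + ψ (u t)) (a + S)
    rw [i1, i2, add_zero, add_zero, hTe,
      intervalIntegral.integral_add_adjacent_intervals
        (intervalIntegrable_mono_Icc h.cost_int m1 m2)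
        (intervalIntegrable_mono_Icc h.cost_int m2 m3),
      intervalIntegral.integral_add_adjacent_intervals
        (intervalIntegrable_mono_Icc h.cost_int m1 m3)
        (intervalIntegrable_mono_Icc h.cost_int m3 m4)]
  linarith

end IsOptimal

lemma even_monotoneOn_le {f : ℝ → ℝ} (he : ∀ r, f (-r) = f r) (hm : MonotoneOn f (Ici 0))
    {r R : ℝ} (h : |r| ≤ R) : f r ≤ f R := by
  have h1 : f |r| = f r := by
    rcases abs_choice r with h | h <;> rw [h]
    exact he r
  rw [← h1]
  exact hm (abs_nonneg r) ((abs_nonneg r).trans h) h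

lemma strictConvexOn_even_pos {ψ : ℝ → ℝ} (hc : StrictConvexOn ℝ univ ψ)
    (he : ∀ r, ψ (-r) = ψ r) (h0 : ψ 0 = 0) {ε : ℝ} (hε : 0 < ε) : 0 < ψ ε := by
  have h := hc.2 (mem_univ ε) (mem_univ (-ε)) (by linarith : ε ≠ -ε)
    (by norm_num : (0:ℝ) < 1 / 2) (by norm_num : (0:ℝ) < 1 / 2) (by norm_num)
  have h1 : (1 / 2 : ℝ) • ε + (1 / 2 : ℝ) • (-ε) = 0 := by simp
  rw [h1, h0, he, smul_eq_mul] at h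
  linarith

lemma abs_le_of_convex_even {ψ : ℝ → ℝ} (hc : ConvexOn ℝ univ ψ) (hnn : ∀ r, 0 ≤ ψ r)
    (he : ∀ r, ψ (-r) = ψ r) (h0 : ψ 0 = 0) {ε : ℝ} (hε : 0 < ε) (hψ : 0 < ψ ε) (r : ℝ) :
    |r| ≤ ε + ε / ψ ε * ψ r := by
  have hq : 0 ≤ ε / ψ ε * ψ r := mul_nonneg (by positivity) (hnn r)
  rcases le_total |r| ε with h | h
  · linarith
  have h1 : ψ |r| = ψ r := by
    rcases abs_choice r with h | h <;> rw [h]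
    exact he r
  have hr : 0 < |r| := hε.trans_le h
  have h2 := hc.2 (mem_univ |r|) (mem_univ 0) (by positivity : 0 ≤ ε / |r|)
    (by rw [sub_nonneg, div_le_one hr]; exact h : 0 ≤ 1 - ε / |r|) (by ring)
  simp only [smul_eq_mul, mul_zero, add_zero, h0, h1] at h2
  rw [div_mul_cancel₀ _ hr.ne', div_mul_eq_mul_div, le_div_iff₀ hr] at h2
  have h3 : |r| ≤ ε / ψ ε * ψ r := by
    rw [div_mul_eq_mul_div, le_div_iff₀ hψ]
    linarith
  linarith

lemma deriv_zero_of_nonneg {f : ℝ → ℝ} (hnn : ∀ r, 0 ≤ f r) (h0 : f 0 = 0) : deriv f 0 = 0 :=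
  IsLocalMin.deriv_eq_zero (Filter.Eventually.of_forall fun r => by rw [h0]; exact hnn r)

lemma convexOn_le_deriv_mul {ψ : ℝ → ℝ} (hc : ConvexOn ℝ univ ψ) (hd : Differentiable ℝ ψ)
    (h0 : ψ 0 = 0) (r : ℝ) : ψ r ≤ deriv ψ r * r := by
  rcases lt_trichotomy r 0 with h | rfl | h
  · have := hc.deriv_le_slope (mem_univ r) (mem_univ 0) h (hd r)
    rw [slope_def_field, h0, le_div_iff₀ (by linarith)] at this
    linarith
  · simp [h0]
  · have := hc.slope_le_deriv (mem_univ 0) (mem_univ r) h (hd r)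
    rw [slope_def_field, h0, div_le_iff₀ (by linarith)] at this
    linarith

lemma intervalIntegrable_of_abs_rpow {u : ℝ → ℝ} {p T : ℝ} (hp : 1 ≤ p) (hu : Measurable u)
    (h : IntervalIntegrable (fun t => |u t| ^ p) volume 0 T) :
    IntervalIntegrable u volume 0 T := by
  refine (intervalIntegrable_const (c := (1:ℝ)).add h).mono_fun hu.aestronglyMeasurable
    (Filter.Eventually.of_forall fun t => ?_)
  have h1 : 0 ≤ |u t| ^ p := by positivity
  simp only [norm_eq_abs]
  refine le_trans ?_ (le_abs_self _)
  rcases le_total |u t| 1 with h | h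
  · linarith
  · have := Real.self_le_rpow_of_one_le h hp
    linarith

/-- The absolutely continuous adjoint variables together with the stationarity condition and
the vanishing of the Hamiltonian along a trajectory. -/
structure Extremal (φ ψ : ℝ → ℝ) (θ κ u : ℝ → ℝ) (T ρ φh : ℝ) (p₃ p₄ : ℝ → ℝ) : Prop where
  ρ_pos : 0 < ρ
  p₃_prim : IsPrimitive p₃ (fun t => ρ * sin (θ t - φh)) T
  p₄_prim : IsPrimitive p₄ (fun t => -(p₃ t) + deriv φ (κ t)) T
  stat : ∀ᵐ t, t ∈ Icc (0:ℝ) T → deriv ψ (u t) = p₄ t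
  ham : ∀ᵐ t, t ∈ Icc (0:ℝ) T → ρ * cos (θ t - φh) + p₃ t * κ t + p₄ t * u t
      - (1 + φ (κ t) + ψ (u t)) = 0

lemma Extremal.restrict {φ ψ θ κ u p₃ p₄ : ℝ → ℝ} {T ρ φh a S : ℝ}
    (h : Extremal φ ψ θ κ u T ρ φh p₃ p₄) (ha : 0 ≤ a) (hS : 0 ≤ S) (haS : a + S ≤ T) :
    Extremal φ ψ (fun s => θ (a + s)) (fun s => κ (a + s)) (fun s => u (a + s)) S ρ φh
      (fun s => p₃ (a + s)) (fun s => p₄ (a + s)) := by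
  have hq := (measurePreserving_add_left (volume : Measure ℝ) a).quasiMeasurePreserving
  refine ⟨h.ρ_pos, h.p₃_prim.restrict ha hS haS, h.p₄_prim.restrict ha hS haS, ?_, ?_⟩
  · filter_upwards [hq.ae h.stat] with s hs hs'
    exact hs ⟨by linarith [hs'.1], by linarith [hs'.2]⟩
  · filter_upwards [hq.ae h.ham] with s hs hs'
    exact hs ⟨by linarith [hs'.1], by linarith [hs'.2]⟩

lemma Connects.arc_and_extremal {φ ψ : ℝ → ℝ} {p : ℝ} {x y θ κ u p₃ p₄ : ℝ → ℝ} {T ρ φh : ℝ}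
    {W₀ W₁ : ℝ × ℝ × ℝ × ℝ} (h1 : H1 φ ψ) (hc : ConvexOn ℝ univ ψ) (hp : 1 ≤ p)
    (hC : Connects p x y θ κ u T W₀ W₁) (hP : PMPData φ ψ θ κ u T ρ φh p₃ p₄) :
    Arc φ ψ p x y θ κ u T ∧ Extremal φ ψ θ κ u T ρ φh p₃ p₄ := by
  obtain ⟨-, hψ0, hφC, hψC, -, -, -, -, -, hψz⟩ := h1
  obtain ⟨hT, hu, hpow, -, -, -, -, hx, hy, hθ, hκ, -, -, -, -⟩ := hC
  obtain ⟨hρ, -, hp₃, hp₄, hst, hham⟩ := hP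
  have hpow' := (intervalIntegrable_iff_integrableOn_Icc_of_le hT.le).2 hpow
  have hui := intervalIntegrable_of_abs_rpow hp hu hpow'
  have κp : IsPrimitive κ u T := ⟨hui, hκ⟩
  have ii : ∀ {g : ℝ → ℝ}, ContinuousOn g (Icc 0 T) → IntervalIntegrable g volume 0 T :=
    fun hg => hg.intervalIntegrable_of_Icc hT.le
  have κc := κp.continuousOn hT.le
  have θp : IsPrimitive θ κ T := ⟨ii κc, hθ⟩
  have θc := θp.continuousOn hT.le
  have p₃p : IsPrimitive p₃ (fun t => ρ * sin (θ t - φh)) T :=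
    ⟨ii (by fun_prop), hp₃⟩
  have p₃c := p₃p.continuousOn hT.le
  have dφ : Continuous (deriv φ) := hφC.continuous_deriv (by norm_num)
  have p₄p : IsPrimitive p₄ (fun t => -(p₃ t) + deriv φ (κ t)) T :=
    ⟨ii (by fun_prop), hp₄⟩
  have p₄c := p₄p.continuousOn hT.le
  rw [ae_restrict_iff' measurableSet_Icc] at hst hham
  refine ⟨⟨hT, hu, hpow', ⟨ii (by fun_prop), hx⟩, ⟨ii (by fun_prop), hy⟩, θp, κp, ?_⟩,
    ⟨hρ, p₃p, p₄p, hst, hham⟩⟩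
  have hφc := hφC.continuous
  have hψc := hψC.continuous
  have i1 : IntervalIntegrable (fun t => 1 + φ (κ t)) volume 0 T :=
    ii (continuousOn_const.add (hφc.comp_continuousOn κc))
  refine i1.add ?_
  have i2 : IntervalIntegrable (fun t => p₄ t * u t) volume 0 T := by
    refine hui.continuousOn_mul ?_
    rwa [uIcc_of_le hT.le]
  refine i2.mono_fun (hψc.measurable.comp hu).aestronglyMeasurable ?_
  rw [uIoc_of_le hT.le, Filter.EventuallyLE, ae_restrict_iff' measurableSet_Ioc]
  filter_upwards [hst] with t ht htT
  have h2 := convexOn_le_deriv_mul hc (hψC.differentiable (by norm_num)) hψz (u t)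
  rw [ht ⟨htT.1.le, htT.2⟩] at h2
  rw [norm_eq_abs, norm_eq_abs, abs_of_nonneg (hψ0 _)]
  exact h2.trans (le_abs_self _)

/-- The cubic on `[0, 1]` with end values `A`, `B` and end slopes `K`, `L`. -/
def hermite (A K B L s : ℝ) : ℝ :=
  A * (2 * s ^ 3 - 3 * s ^ 2 + 1) + K * (s ^ 3 - 2 * s ^ 2 + s) + B * (3 * s ^ 2 - 2 * s ^ 3)
    + L * (s ^ 3 - s ^ 2)

/-- The derivative of `hermite`. -/
def hermiteDeriv (A K B L s : ℝ) : ℝ :=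
  A * (6 * s ^ 2 - 6 * s) + K * (3 * s ^ 2 - 4 * s + 1) + B * (6 * s - 6 * s ^ 2)
    + L * (3 * s ^ 2 - 2 * s)

/-- The second derivative of `hermite`. -/
def hermiteDerivTwo (A K B L s : ℝ) : ℝ :=
  A * (12 * s - 6) + K * (6 * s - 4) + B * (6 - 12 * s) + L * (6 * s - 2)

section Hermite

variable (A K B L s : ℝ)

lemma hasDerivAt_hermite : HasDerivAt (hermite A K B L) (hermiteDeriv A K B L s) s := by
  have h3 := hasDerivAt_pow 3 s
  have h2 := hasDerivAt_pow 2 s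
  have h1 := hasDerivAt_id s
  have := (((((h3.const_mul 2).sub (h2.const_mul 3)).add_const 1).const_mul A).add
    (((h3.sub (h2.const_mul 2)).add h1).const_mul K)).add
    (((h2.const_mul 3).sub (h3.const_mul 2)).const_mul B) |>.add ((h3.sub h2).const_mul L)
  refine this.congr_deriv ?_
  simp only [hermiteDeriv]
  norm_num
  ring

lemma hasDerivAt_hermiteDeriv :
    HasDerivAt (hermiteDeriv A K B L) (hermiteDerivTwo A K B L s) s := by
  have h2 := hasDerivAt_pow 2 s
  have h1 := hasDerivAt_id s
  have := ((((h2.const_mul 6).sub (h1.const_mul 6)).const_mul A).add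
    ((((h2.const_mul 3).sub (h1.const_mul 4)).add_const 1).const_mul K)).add
    (((h1.const_mul 6).sub (h2.const_mul 6)).const_mul B) |>.add
    (((h2.const_mul 3).sub (h1.const_mul 2)).const_mul L)
  refine this.congr_deriv ?_
  simp only [hermiteDerivTwo]
  norm_num
  ring

variable {A K B L s}

lemma abs_comb_le {r a k b l : ℝ} (hA : |A| ≤ r) (hK : |K| ≤ r) (hB : |B| ≤ r) (hL : |L| ≤ r)
    (ha : |a| ≤ 6) (hk : |k| ≤ 4) (hb : |b| ≤ 6) (hl : |l| ≤ 4) :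
    |A * a + K * k + B * b + L * l| ≤ 20 * r := by
  have hr : 0 ≤ r := (abs_nonneg A).trans hA
  have e1 := mul_le_mul hA ha (abs_nonneg _) hr
  have e2 := mul_le_mul hK hk (abs_nonneg _) hr
  have e3 := mul_le_mul hB hb (abs_nonneg _) hr
  have e4 := mul_le_mul hL hl (abs_nonneg _) hr
  rw [← abs_mul] at e1 e2 e3 e4
  calc _ ≤ |A * a| + |K * k| + |B * b| + |L * l| := by
        refine (abs_add_le _ _).trans (add_le_add_left ((abs_add_le _ _).trans
          (add_le_add_left (abs_add_le _ _) _)) _)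
    _ ≤ 20 * r := by linarith

lemma abs_hermite_le {r : ℝ} (hA : |A| ≤ r) (hK : |K| ≤ r) (hB : |B| ≤ r) (hL : |L| ≤ r)
    (hs : s ∈ Icc (0:ℝ) 1) : |hermite A K B L s| ≤ 20 * r ∧ |hermiteDeriv A K B L s| ≤ 20 * r ∧
      |hermiteDerivTwo A K B L s| ≤ 20 * r := by
  obtain ⟨h0, h1⟩ := hs
  have q2 : s ^ 2 ≤ 1 := by nlinarith
  have q2' : 0 ≤ s ^ 2 := by positivity
  have q3 : s ^ 3 ≤ 1 := pow_le_one₀ h0 h1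
  have q3' : 0 ≤ s ^ 3 := by positivity
  have q32 : s ^ 3 ≤ s ^ 2 := by nlinarith
  refine ⟨abs_comb_le hA hK hB hL ?_ ?_ ?_ ?_, abs_comb_le hA hK hB hL ?_ ?_ ?_ ?_,
    abs_comb_le hA hK hB hL ?_ ?_ ?_ ?_⟩ <;> rw [abs_le] <;> constructor <;> linarith

end Hermite

/-- A bound for the excess cost of a unit-time manoeuvre in which angle, curvature and control
are bounded by `r`. -/
def excessBound (φ ψ : ℝ → ℝ) (r : ℝ) : ℝ := r ^ 2 / 2 + φ r + ψ r

lemma exists_hermite_arc {φ ψ : ℝ → ℝ} {p : ℝ} (h1 : H1 φ ψ) (hp : 0 ≤ p)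
    {A K B L r : ℝ} (hA : |A| ≤ r) (hK : |K| ≤ r) (hB : |B| ≤ r) (hL : |L| ≤ r) (b x₀ y₀ : ℝ) :
    ∃ x y : ℝ → ℝ, Arc φ ψ p x y (fun s => b + hermite A K B L s) (hermiteDeriv A K B L)
        (hermiteDerivTwo A K B L) 1 ∧ x 0 = x₀ ∧ y 0 = y₀ ∧
      x 1 = x₀ + (cos b * (∫ s in (0:ℝ)..1, cos (hermite A K B L s))
        - sin b * ∫ s in (0:ℝ)..1, sin (hermite A K B L s)) ∧
      y 1 = y₀ + (sin b * (∫ s in (0:ℝ)..1, cos (hermite A K B L s))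
        + cos b * ∫ s in (0:ℝ)..1, sin (hermite A K B L s)) ∧
      cost φ ψ (hermiteDeriv A K B L) (hermiteDerivTwo A K B L) 1 ≤
        (∫ s in (0:ℝ)..1, cos (hermite A K B L s)) + excessBound φ ψ (20 * r) := by
  obtain ⟨-, -, hφC, hψC, hφe, hψe, hφm, hψm, -, -⟩ := h1
  have hφc := hφC.continuous
  have hψc := hψC.continuous
  have c0 : Continuous (hermite A K B L) := by unfold hermite; fun_prop
  have c2 : Continuous (hermiteDerivTwo A K B L) := by unfold hermiteDerivTwo; fun_prop
  have arc := Arc.of_hasDerivAt (φ := φ) (ψ := ψ) (p := p) hφc hψc hp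
    (fun t => (hasDerivAt_hermite A K B L t).const_add b) (hasDerivAt_hermiteDeriv A K B L) c2
    one_pos x₀ y₀
  have ic : IntervalIntegrable (fun s => cos (hermite A K B L s)) volume 0 1 :=
    (by fun_prop : Continuous _).intervalIntegrable _ _
  have is : IntervalIntegrable (fun s => sin (hermite A K B L s)) volume 0 1 :=
    (by fun_prop : Continuous _).intervalIntegrable _ _
  refine ⟨_, _, arc, by simp, by simp, ?_, ?_, ?_⟩
  · simp only [cos_add]
    rw [intervalIntegral.integral_sub (ic.const_mul _) (is.const_mul _),
      intervalIntegral.integral_const_mul, intervalIntegral.integral_const_mul]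
  · simp only [sin_add]
    rw [intervalIntegral.integral_add (ic.const_mul _) (is.const_mul _),
      intervalIntegral.integral_const_mul, intervalIntegral.integral_const_mul]
  · unfold cost
    have hle := intervalIntegral.integral_mono_on zero_le_one arc.cost_int
      (ic.add (intervalIntegrable_const (c := excessBound φ ψ (20 * r)))) fun s hs => by
        obtain ⟨b0, b1, b2⟩ := abs_hermite_le hA hK hB hL hs
        have e1 := even_monotoneOn_le hφe hφm b1
        have e2 := even_monotoneOn_le hψe hψm b2
        have e0 := Real.one_sub_sq_div_two_le_cos (x := hermite A K B L s)
        have e3 : hermite A K B L s ^ 2 ≤ (20 * r) ^ 2 := sq_le_sq' (abs_le.1 b0).1 (abs_le.1 b0).2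
        show _ ≤ cos (hermite A K B L s) + excessBound φ ψ (20 * r)
        unfold excessBound
        linarith
    refine hle.trans_eq ?_
    rw [intervalIntegral.integral_add ic intervalIntegrable_const]
    simp

lemma exists_line_arc {φ ψ : ℝ → ℝ} {p : ℝ} (h1 : H1 φ ψ) (hp : 0 ≤ p) {ℓ : ℝ} (hℓ : 0 < ℓ)
    (b x₀ y₀ : ℝ) :
    ∃ x y : ℝ → ℝ, Arc φ ψ p x y (fun _ => b) (fun _ => 0) (fun _ => 0) ℓ ∧ x 0 = x₀ ∧
      y 0 = y₀ ∧ x ℓ = x₀ + ℓ * cos b ∧ y ℓ = y₀ + ℓ * sin b ∧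
      cost φ ψ (fun _ => 0) (fun _ => 0) ℓ = ℓ := by
  obtain ⟨-, -, hφC, hψC, -, -, -, -, hφ, hψ⟩ := h1
  refine ⟨_, _, Arc.of_hasDerivAt hφC.continuous hψC.continuous hp
    (fun t => hasDerivAt_const t b) (fun t => hasDerivAt_const t 0) continuous_const hℓ x₀ y₀,
    ?_, ?_, ?_, ?_, ?_⟩ <;> simp [cost, hφ, hψ]

lemma exists_arc_of_displacement {φ ψ : ℝ → ℝ} {p : ℝ} (h1 : H1 φ ψ) (hp : 0 ≤ p)
    {D δ δ₀ β θa κa θb κb : ℝ} (x₀ y₀ : ℝ) (hδ₀ : 0 < δ₀) (hδ₀' : δ₀ ≤ π / 6)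
    (hD : 2 ≤ D * sin δ₀) (hθa : |θa - β| ≤ δ) (hθb : |θb - β| ≤ δ) (hκa : |κa| ≤ δ)
    (hκb : |κb| ≤ δ) :
    ∃ (x y θ κ u : ℝ → ℝ) (S : ℝ), Arc φ ψ p x y θ κ u S ∧
      x 0 = x₀ ∧ y 0 = y₀ ∧ θ 0 = θa ∧ κ 0 = κa ∧
      x S = x₀ + D * cos β ∧ y S = y₀ + D * sin β ∧ θ S = θb ∧ κ S = κb ∧
      cost φ ψ κ u S ≤ D + 2 * excessBound φ ψ (20 * (δ + δ₀)) := by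
  have hδ : 0 ≤ δ := (abs_nonneg _).trans hκa
  have hsin : 0 < sin δ₀ := sin_pos_of_pos_of_lt_pi hδ₀ (by linarith [pi_pos])
  have hsin' : sin δ₀ ≤ 1 / 2 := by
    rw [← sin_pi_div_six]
    exact sin_le_sin_of_le_of_le_pi_div_two (by linarith) (by linarith [pi_pos]) hδ₀'
  have hD4 : 4 ≤ D := by
    by_contra h
    nlinarith
  set g₁ : ℝ → ℝ → ℝ := fun b s => hermite (θa - b) κa 0 0 s with hg₁
  set g₂ : ℝ → ℝ → ℝ := fun b s => hermite 0 0 (θb - b) κb s with hg₂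
  have abs_int : ∀ {f : ℝ → ℝ}, (∀ s, |f s| ≤ 1) → |∫ s in (0:ℝ)..1, f s| ≤ 1 := fun {f} hf => by
    simpa using intervalIntegral.norm_integral_le_of_norm_le_const (a := 0) (b := 1) (C := 1)
      (f := f) fun s _ => hf s
  set s₁ : ℝ → ℝ := fun b => ∫ s in (0:ℝ)..1, sin (g₁ b s) with hs₁
  set s₂ : ℝ → ℝ := fun b => ∫ s in (0:ℝ)..1, sin (g₂ b s) with hs₂
  set c₁ : ℝ → ℝ := fun b => ∫ s in (0:ℝ)..1, cos (g₁ b s) with hc₁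
  set c₂ : ℝ → ℝ := fun b => ∫ s in (0:ℝ)..1, cos (g₂ b s) with hc₂
  have bs₁ : ∀ b, |s₁ b| ≤ 1 := fun b => abs_int fun s => abs_sin_le_one _
  have bs₂ : ∀ b, |s₂ b| ≤ 1 := fun b => abs_int fun s => abs_sin_le_one _
  have bc₁ : ∀ b, |c₁ b| ≤ 1 := fun b => abs_int fun s => abs_cos_le_one _
  have bc₂ : ∀ b, |c₂ b| ≤ 1 := fun b => abs_int fun s => abs_cos_le_one _
  have cs₁ : Continuous s₁ := intervalIntegral.continuous_parametric_intervalIntegral_of_continuous'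
    (by simp only [hg₁, hermite, Function.uncurry_def]; fun_prop) 0 1
  have cs₂ : Continuous s₂ := intervalIntegral.continuous_parametric_intervalIntegral_of_continuous'
    (by simp only [hg₂, hermite, Function.uncurry_def]; fun_prop) 0 1
  obtain ⟨b, hb, hb0⟩ : ∃ b ∈ Icc (β - δ₀) (β + δ₀), D * sin (β - b) - s₁ b - s₂ b = 0 := by
    refine intermediate_value_Icc' (f := fun b => D * sin (β - b) - s₁ b - s₂ b)
      (by linarith) (by fun_prop) ⟨?_, ?_⟩
    · have e : β - (β + δ₀) = -δ₀ := by ring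
      simp only [e, sin_neg]
      linarith [(abs_le.1 (bs₁ (β + δ₀))).1, (abs_le.1 (bs₂ (β + δ₀))).1]
    · have e : β - (β - δ₀) = δ₀ := by ring
      simp only [e]
      linarith [(abs_le.1 (bs₁ (β - δ₀))).2, (abs_le.1 (bs₂ (β - δ₀))).2]
  have hβb : |β - b| ≤ δ₀ := abs_le.2 ⟨by linarith [hb.2], by linarith [hb.1]⟩
  have hcos : 1 / 2 < cos (β - b) := by
    rw [← cos_abs, ← cos_pi_div_three]
    exact cos_lt_cos_of_nonneg_of_le_pi_div_two (abs_nonneg _) (by linarith [pi_pos])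
      (by linarith [pi_pos])
  set ℓ := D * cos (β - b) - c₁ b - c₂ b with hℓ
  have hℓ0 : 0 < ℓ := by
    have : 2 < D * cos (β - b) := by nlinarith
    linarith [(abs_le.1 (bc₁ b)).2, (abs_le.1 (bc₂ b)).2]
  have hz : |(0:ℝ)| ≤ δ + δ₀ := by simp; linarith
  have hab : |θa - b| ≤ δ + δ₀ := by
    have := abs_add_le (θa - β) (β - b)
    rw [sub_add_sub_cancel] at this
    linarith
  have hbb : |θb - b| ≤ δ + δ₀ := by
    have := abs_add_le (θb - β) (β - b)
    rw [sub_add_sub_cancel] at this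
    linarith
  obtain ⟨x1, y1, A1, x10, y10, x11, y11, C1⟩ := exists_hermite_arc h1 hp hab
    (by linarith : |κa| ≤ δ + δ₀) hz hz b x₀ y₀
  obtain ⟨x2, y2, A2, x20, y20, x21, y21, C2⟩ := exists_line_arc h1 hp hℓ0 b (x1 1) (y1 1)
  obtain ⟨x3, y3, A3, x30, y30, x31, y31, C3⟩ := exists_hermite_arc h1 hp hz hz hbb
    (by linarith : |κb| ≤ δ + δ₀) b (x2 ℓ) (y2 ℓ)
  have A12 := A1.concat A2 x20.symm y20.symm (by simp only [hermite]; ring)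
    (by simp only [hermiteDeriv]; ring)
  have A123 := A12.concat A3 (by rw [concat_end hℓ0, x30]) (by rw [concat_end hℓ0, y30])
    (by rw [concat_end hℓ0]; simp [hermite]) (by rw [concat_end hℓ0]; simp [hermiteDeriv])
  have n1 : (0:ℝ) ≤ 1 + ℓ := by linarith
  have dec : ∀ v w : ℝ, D * cos (β - b) * v + (s₁ b + s₂ b) * w =
      D * (cos (β - b) * v + sin (β - b) * w) := fun v w => by
    linear_combination (-w) * hb0
  refine ⟨_, _, _, _, _, _, A123, ?_, ?_, ?_, ?_, ?_, ?_, ?_, ?_, ?_⟩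
  · rw [concat_left n1, concat_left zero_le_one, x10]
  · rw [concat_left n1, concat_left zero_le_one, y10]
  · rw [concat_left n1, concat_left zero_le_one]
    simp [hermite]
  · rw [concat_left n1, concat_left zero_le_one]
    simp [hermiteDeriv]
  · rw [concat_end one_pos, x31, x21, x11]
    have e := dec (cos b) (-sin b)
    have e2 : cos β = cos (β - b) * cos b + sin (β - b) * -sin b := by
      have := cos_add (β - b) b
      rw [sub_add_cancel] at this
      linarith
    rw [e2, ← e, hℓ]
    ring
  · rw [concat_end one_pos, y31, y21, y11]
    have e := dec (sin b) (cos b)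
    have e2 : sin β = cos (β - b) * sin b + sin (β - b) * cos b := by
      have := sin_add (β - b) b
      rw [sub_add_cancel] at this
      linarith
    rw [e2, ← e, hℓ]
    ring
  · rw [concat_end one_pos]
    simp only [hermite]
    ring
  · rw [concat_end one_pos]
    simp only [hermiteDeriv]
    ring
  · rw [A12.cost_concat A3, A1.cost_concat A2, C2]
    have : D * cos (β - b) ≤ D := mul_le_of_le_one_right (by linarith) (cos_le_one _)
    change _ ≤ c₁ b + _ at C1
    change _ ≤ c₂ b + _ at C3
    linarith

lemma exists_le_of_integral_le {E : ℝ → ℝ} {P : ℝ → Prop} {r s η : ℝ} (hrs : r < s)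
    (hE : IntervalIntegrable E volume r s) (h : ∫ t in r..s, E t ≤ η)
    (hP : ∀ᵐ t, t ∈ Icc r s → P t) : ∃ t ∈ Icc r s, P t ∧ E t ≤ η / (s - r) := by
  have hN : (volume.restrict (Ioc r s)) {t | ¬ (t ∈ Icc r s ∧ P t)} = 0 := by
    rw [← MeasureTheory.ae_iff, ae_restrict_iff' measurableSet_Ioc]
    filter_upwards [hP] with t ht ht'
    exact ⟨Ioc_subset_Icc_self ht', ht (Ioc_subset_Icc_self ht')⟩
  have hμ : volume.restrict (Ioc r s) ≠ 0 := by
    simp [Measure.restrict_eq_zero, hrs]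
  obtain ⟨t, ht, hle⟩ := exists_notMem_null_le_average hμ
    ((intervalIntegrable_iff_integrableOn_Ioc_of_le hrs.le).1 hE) hN
  simp only [mem_ofPred_eq, not_not] at ht
  refine ⟨t, ht.1, ht.2, hle.trans ?_⟩
  have h1 := interval_average_eq E r s
  rw [uIoc_of_le hrs.le] at h1
  rw [h1, smul_eq_mul, inv_mul_eq_div]
  exact div_le_div_of_nonneg_right h (by linarith)

lemma IsPrimitive.hasDerivAt {f g : ℝ → ℝ} {T t : ℝ} (h : IsPrimitive f g T)
    (hg : ContinuousOn g (Icc 0 T)) (ht : t ∈ Ioo 0 T) : HasDerivAt f (g t) t := by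
  have hn : Icc 0 T ∈ nhds t := Icc_mem_nhds ht.1 ht.2
  have h1 := intervalIntegral.integral_hasDerivAt_right
    (intervalIntegrable_mono_Icc h.1 ⟨le_rfl, ht.1.le.trans ht.2.le⟩ ⟨ht.1.le, ht.2.le⟩)
    ((hg.mono Ioo_subset_Icc_self).stronglyMeasurableAtFilter isOpen_Ioo t ht)
    (hg.continuousAt hn)
  refine (h1.const_add (f 0)).congr_of_eventuallyEq ?_
  filter_upwards [hn] with s hs using h.2 s hs

lemma IsPrimitive.abs_sub_le {f g : ℝ → ℝ} {C s t : ℝ} (h : IsPrimitive f g 1)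
    (hg : ∀ s ∈ Icc (0:ℝ) 1, |g s| ≤ C) (hs : s ∈ Icc (0:ℝ) 1) (ht : t ∈ Icc (0:ℝ) 1) :
    |f t - f s| ≤ C := by
  have hC : 0 ≤ C := (abs_nonneg _).trans (hg s hs)
  rw [h.sub_eq hs ht]
  refine (intervalIntegral.norm_integral_le_of_norm_le_const (f := g) (C := C) fun x hx =>
    hg x (uIcc_subset_Icc hs ht (uIoc_subset_uIcc hx))).trans ?_
  have : |t - s| ≤ 1 := abs_le.2 ⟨by linarith [hs.2, ht.1], by linarith [ht.2, hs.1]⟩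
  nlinarith

/-- Over a unit time interval with small excess cost relative to the direction `γ`, the curvature
is small and the angle is close to `γ`. -/
lemma small_of_excess_le {φ ψ θ κ u : ℝ → ℝ} {γ η ε : ℝ} (h1 : H1 φ ψ)
    (hc : ConvexOn ℝ univ ψ) (hθ : IsPrimitive θ κ 1) (hκ : IsPrimitive κ u 1)
    (hE : IntervalIntegrable (fun t => 1 + φ (κ t) + ψ (u t) - cos (θ t - γ)) volume 0 1)
    (hη : ∫ t in (0:ℝ)..1, (1 + φ (κ t) + ψ (u t) - cos (θ t - γ)) ≤ η)
    (hε : 0 < ε) (hε1 : ε ≤ 1) (hηψ : η ≤ ψ ε) (hηε : 8 * η ≤ ε ^ 2) (hψε : 0 < ψ ε) :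
    ∀ s ∈ Icc (0:ℝ) 1, |κ s| ≤ 18 * ε ∧ 1 - cos (θ s - γ) ≤ 20 * ε := by
  obtain ⟨hφ0, hψ0, -, -, -, hψe, -, -, -, hψz⟩ := h1
  set E : ℝ → ℝ := fun t => 1 + φ (κ t) + ψ (u t) - cos (θ t - γ) with hEdef
  have E0 : ∀ t, 0 ≤ E t := fun t => by
    have := cos_le_one (θ t - γ)
    linarith [hφ0 (κ t), hψ0 (u t)]
  have Eψ : ∀ t, ψ (u t) ≤ E t := fun t => by
    have := cos_le_one (θ t - γ)
    linarith [hφ0 (κ t)]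
  have Ec : ∀ t, 1 - cos (θ t - γ) ≤ E t := fun t => by
    linarith [hφ0 (κ t), hψ0 (u t)]
  have κc := hκ.continuousOn zero_le_one
  have θc := hθ.continuousOn zero_le_one
  have m0 : (0:ℝ) ∈ Icc (0:ℝ) 1 := ⟨le_rfl, zero_le_one⟩
  have m1 : (1:ℝ) ∈ Icc (0:ℝ) 1 := ⟨zero_le_one, le_rfl⟩
  have Esub : ∀ {r s : ℝ}, 0 ≤ r → r ≤ s → s ≤ 1 → ∫ t in r..s, E t ≤ η := fun h0 hrs hs =>
    (intervalIntegral.integral_mono_interval h0 hrs hs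
      (Filter.Eventually.of_forall E0) hE).trans hη
  have hui : ∫ t in (0:ℝ)..1, |u t| ≤ 2 * ε := by
    have h := intervalIntegral.integral_mono_on zero_le_one hκ.1.abs
      (intervalIntegrable_const.add (hE.const_mul (ε / ψ ε)) :
        IntervalIntegrable (fun t => ε + ε / ψ ε * E t) volume 0 1) fun t _ => by
        have h2 := abs_le_of_convex_even hc hψ0 hψe hψz hε hψε (u t)
        have h3 : ε / ψ ε * ψ (u t) ≤ ε / ψ ε * E t :=
          mul_le_mul_of_nonneg_left (Eψ t) (by positivity)
        linarith
    rw [intervalIntegral.integral_add intervalIntegrable_const (hE.const_mul _),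
      intervalIntegral.integral_const_mul] at h
    have h4 : ε / ψ ε * ∫ t in (0:ℝ)..1, E t ≤ ε / ψ ε * ψ ε :=
      mul_le_mul_of_nonneg_left (hη.trans hηψ) (by positivity)
    rw [div_mul_cancel₀ _ hψε.ne'] at h4
    simp only [intervalIntegral.integral_const, sub_zero, one_smul] at h
    linarith
  have hκ0 : ∀ s ∈ Icc (0:ℝ) 1, |κ s - κ 0| ≤ 2 * ε := fun s hs => by
    rw [hκ.sub_eq m0 hs]
    refine (intervalIntegral.abs_integral_le_integral_abs hs.1).trans (le_trans ?_ hui)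
    exact intervalIntegral.integral_mono_interval le_rfl hs.1 hs.2
      (Filter.Eventually.of_forall fun t => abs_nonneg (u t)) hκ.1.abs
  have good : ∀ {r s : ℝ}, 0 ≤ r → s = r + 1 / 4 → s ≤ 1 →
      ∃ t ∈ Icc r s, 1 - cos (θ t - γ) ≤ 4 * η ∧ |sin (θ t - γ)| ≤ ε := fun {r s} h0 hrs hs => by
    obtain ⟨t, ht, -, hle⟩ := exists_le_of_integral_le (P := fun _ => True) (r := r) (s := s)
      (by linarith) (intervalIntegrable_mono_Icc hE ⟨h0, by linarith⟩ ⟨by linarith, hs⟩)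
      (Esub h0 (by linarith) hs) (by simp)
    have hsr : s - r = 1 / 4 := by linarith
    rw [hsr] at hle
    have h4 : 1 - cos (θ t - γ) ≤ 4 * η := by linarith [Ec t]
    refine ⟨t, ht, h4, abs_le_of_sq_le_sq ?_ hε.le⟩
    nlinarith [sin_sq_add_cos_sq (θ t - γ), cos_le_one (θ t - γ)]
  obtain ⟨r, hr, hr1, hr2⟩ := good le_rfl (zero_add (1 / 4 : ℝ)).symm (by norm_num)
  obtain ⟨s, hs, hs1, hs2⟩ := good (r := 3 / 4) (s := 1) (by norm_num) (by norm_num) le_rfl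
  have mr : r ∈ Icc (0:ℝ) 1 := ⟨hr.1, by linarith [hr.2]⟩
  have ms : s ∈ Icc (0:ℝ) 1 := ⟨by linarith [hs.1], hs.2⟩
  have hrs : r ≤ s := by linarith [hr.2, hs.1]
  have sub : Icc r s ⊆ Icc 0 1 := Icc_subset_Icc mr.1 ms.2
  have icos : IntervalIntegrable (fun t => cos (θ t - γ)) volume r s :=
    ContinuousOn.intervalIntegrable_of_Icc hrs (by have := θc.mono sub; fun_prop)
  have iκcos : IntervalIntegrable (fun t => κ t * cos (θ t - γ)) volume r s :=
    ContinuousOn.intervalIntegrable_of_Icc hrs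
      (by have := θc.mono sub; have := κc.mono sub; fun_prop)
  have ftc : ∫ t in r..s, κ t * cos (θ t - γ) = sin (θ s - γ) - sin (θ r - γ) := by
    refine intervalIntegral.integral_eq_sub_of_hasDerivAt_of_le (f := fun t => sin (θ t - γ)) hrs
      (by have := θc.mono sub; fun_prop) (fun t ht => ?_) iκcos
    have hd := (hθ.hasDerivAt κc ⟨mr.1.trans_lt ht.1, ht.2.trans_le ms.2⟩).sub_const γ
    have := (hasDerivAt_sin (θ t - γ)).comp t hd
    rwa [mul_comm] at this
  have cosint : s - r - η ≤ ∫ t in r..s, cos (θ t - γ) := by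
    have h := intervalIntegral.integral_mono_on hrs (intervalIntegrable_const.sub icos)
      (intervalIntegrable_mono_Icc hE mr ms) fun t _ => Ec t
    rw [intervalIntegral.integral_sub intervalIntegrable_const icos] at h
    simp only [intervalIntegral.integral_const, smul_eq_mul, mul_one] at h
    linarith [Esub mr.1 hrs ms.2]
  have dev : |(∫ t in r..s, κ t * cos (θ t - γ)) - κ 0 * ∫ t in r..s, cos (θ t - γ)| ≤ 2 * ε := by
    rw [← intervalIntegral.integral_const_mul,
      ← intervalIntegral.integral_sub iκcos (icos.const_mul _)]
    refine (intervalIntegral.norm_integral_le_of_norm_le_const (C := 2 * ε)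
      (f := fun t => κ t * cos (θ t - γ) - κ 0 * cos (θ t - γ)) fun t ht => ?_).trans ?_
    · rw [uIoc_of_le hrs] at ht
      rw [← sub_mul, norm_mul, norm_eq_abs, norm_eq_abs]
      have ha := hκ0 t (sub (Ioc_subset_Icc_self ht))
      have hb := abs_cos_le_one (θ t - γ)
      nlinarith [abs_nonneg (κ t - κ 0)]
    · rw [abs_of_nonneg (by linarith)]
      nlinarith [mr.1, ms.2]
  have hη8 : 8 * η ≤ 1 := by nlinarith
  have k0 : |κ 0| ≤ 11 * ε := by
    have hI : 3 / 8 ≤ ∫ t in r..s, cos (θ t - γ) := by linarith [hr.2, hs.1]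
    have hp : |κ 0 * ∫ t in r..s, cos (θ t - γ)| ≤ 4 * ε := by
      rw [ftc] at dev
      rw [abs_le] at dev hr2 hs2 ⊢
      constructor <;> linarith [dev.1, dev.2, hr2.1, hr2.2, hs2.1, hs2.2]
    rw [abs_mul, abs_of_nonneg (by linarith : 0 ≤ ∫ t in r..s, cos (θ t - γ))] at hp
    nlinarith [abs_nonneg (κ 0)]
  have κb : ∀ t ∈ Icc (0:ℝ) 1, |κ t| ≤ 18 * ε := fun t ht => by
    have := abs_add_le (κ t - κ 0) (κ 0)
    rw [sub_add_cancel] at this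
    linarith [hκ0 t ht]
  intro t ht
  refine ⟨κb t ht, ?_⟩
  have h := abs_cos_sub_cos_le (θ t - γ) (θ r - γ)
  rw [sub_sub_sub_cancel_right] at h
  have h' := hθ.abs_sub_le κb mr ht
  have := (abs_le.1 (h.trans h')).1
  nlinarith

/-- A quadratic polynomial that is small at three separated points has small coefficients. -/
lemma abs_quadratic_coeff_le {a b c e s₀ s₁ s₂ : ℝ} (hs₀ : s₀ ∈ Icc (0:ℝ) (1 / 5))
    (hs₁ : s₁ ∈ Icc (2 / 5 : ℝ) (3 / 5)) (hs₂ : s₂ ∈ Icc (4 / 5 : ℝ) 1)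
    (h₀ : |a + b * s₀ + c * s₀ ^ 2| ≤ e) (h₁ : |a + b * s₁ + c * s₁ ^ 2| ≤ e)
    (h₂ : |a + b * s₂ + c * s₂ ^ 2| ≤ e) : |a| ≤ 11 * e ∧ |b| ≤ 38 * e ∧ |c| ≤ 34 * e := by
  obtain ⟨p0, q0⟩ := hs₀
  obtain ⟨p1, q1⟩ := hs₁
  obtain ⟨p2, q2⟩ := hs₂
  have he : 0 ≤ e := (abs_nonneg _).trans h₀
  have slope : ∀ {s t : ℝ}, 1 / 5 ≤ t - s → |a + b * s + c * s ^ 2| ≤ e →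
      |a + b * t + c * t ^ 2| ≤ e → |b + c * (s + t)| ≤ 10 * e := fun {s t} hst hs ht => by
    have h : |(b + c * (s + t)) * (t - s)| ≤ 2 * e := by
      have e1 : (b + c * (s + t)) * (t - s) =
        (a + b * t + c * t ^ 2) - (a + b * s + c * s ^ 2) := by ring
      rw [e1]
      exact (abs_sub _ _).trans (by linarith)
    rw [abs_mul, abs_of_nonneg (by linarith : 0 ≤ t - s)] at h
    nlinarith [abs_nonneg (b + c * (s + t))]
  have e01 := slope (by linarith : 1 / 5 ≤ s₁ - s₀) h₀ h₁
  have e12 := slope (by linarith : 1 / 5 ≤ s₂ - s₁) h₁ h₂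
  have hc : |c| ≤ 34 * e := by
    have h : |c * (s₂ - s₀)| ≤ 20 * e := by
      have e1 : c * (s₂ - s₀) = (b + c * (s₁ + s₂)) - (b + c * (s₀ + s₁)) := by ring
      rw [e1]
      exact (abs_sub _ _).trans (by linarith)
    rw [abs_mul, abs_of_nonneg (by linarith : 0 ≤ s₂ - s₀)] at h
    nlinarith [abs_nonneg c]
  have hb : |b| ≤ 38 * e := by
    have e1 : b = (b + c * (s₀ + s₁)) - c * (s₀ + s₁) := by ring
    have e2 : |c * (s₀ + s₁)| ≤ 34 * e * (4 / 5) := by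
      rw [abs_mul, abs_of_nonneg (by linarith : 0 ≤ s₀ + s₁)]
      exact mul_le_mul hc (by linarith) (by linarith) (by linarith)
    rw [e1]
    exact (abs_sub _ _).trans (by linarith)
  refine ⟨?_, hb, hc⟩
  have e1 : a = (a + b * s₀ + c * s₀ ^ 2) - b * s₀ - c * s₀ ^ 2 := by ring
  have e2 : |b * s₀| ≤ 38 * e * (1 / 5) := by
    rw [abs_mul, abs_of_nonneg p0]
    exact mul_le_mul hb q0 p0 (by linarith)
  have e3 : |c * s₀ ^ 2| ≤ 34 * e * (1 / 25) := by
    rw [abs_mul, abs_of_nonneg (by positivity : 0 ≤ s₀ ^ 2)]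
    exact mul_le_mul hc (by nlinarith) (by positivity) (by linarith)
  rw [e1]
  have f1 := abs_sub (a + b * s₀ + c * s₀ ^ 2 - b * s₀) (c * s₀ ^ 2)
  have f2 := abs_sub (a + b * s₀ + c * s₀ ^ 2) (b * s₀)
  linarith

/-- The `ℓ¹` norm of a planar vector dominates its length. -/
lemma le_abs_mul_cos_add_abs_mul_sin {ρ : ℝ} (hρ : 0 < ρ) (x : ℝ) :
    ρ ≤ |ρ * cos x| + |ρ * sin x| := by
  rw [abs_mul, abs_mul, abs_of_pos hρ, ← mul_add]
  refine le_mul_of_one_le_right hρ.le ?_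
  have k1 := abs_cos_le_one x
  have k2 := abs_sin_le_one x
  have k3 := sin_sq_add_cos_sq x
  rw [← sq_abs (sin _), ← sq_abs (cos _)] at k3
  nlinarith [abs_nonneg (cos x), abs_nonneg (sin x)]

/-- On a unit interval along which the angle hardly moves, `p₃` is nearly affine and `p₄` is
nearly quadratic. -/
lemma adjoint_approx {φ ψ : ℝ → ℝ} {θ κ u p₃ p₄ : ℝ → ℝ} {ρ φh μ : ℝ} (hθ : IsPrimitive θ κ 1)
    (hX : Extremal φ ψ θ κ u 1 ρ φh p₃ p₄) (hκ : ∀ s ∈ Icc (0:ℝ) 1, |κ s| ≤ μ)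
    (hφ' : ∀ s ∈ Icc (0:ℝ) 1, |deriv φ (κ s)| ≤ μ) :
    ∃ B : ℝ, (∀ s ∈ Icc (0:ℝ) 1, |ρ * sin (θ s - φh) - B| ≤ μ * ρ) ∧
      (∀ s ∈ Icc (0:ℝ) 1, |p₃ s - (p₃ 0 + B * s)| ≤ μ * ρ) ∧
      ∀ s ∈ Icc (0:ℝ) 1, |p₄ s - (p₄ 0 + -(p₃ 0) * s + -(B / 2) * s ^ 2)| ≤ μ * ρ + μ := by
  obtain ⟨hρ, hp₃, hp₄, -, -⟩ := hX
  have m0 : (0:ℝ) ∈ Icc (0:ℝ) 1 := ⟨le_rfl, zero_le_one⟩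
  have hsin : ∀ s ∈ Icc (0:ℝ) 1,
      |ρ * sin (θ s - φh) - ρ * sin (θ 0 - φh)| ≤ μ * ρ := fun s hs => by
    rw [← mul_sub, abs_mul, abs_of_pos hρ, mul_comm μ]
    refine mul_le_mul_of_nonneg_left ?_ hρ.le
    refine (Real.abs_sin_sub_sin_le _ _).trans ?_
    rw [sub_sub_sub_cancel_right]
    exact hθ.abs_sub_le hκ m0 hs
  obtain ⟨B, hB⟩ : ∃ B, B = ρ * sin (θ 0 - φh) := ⟨_, rfl⟩
  rw [← hB] at hsin
  have hq₃ : IsPrimitive (fun s => p₃ s - (p₃ 0 + B * s)) (fun s => ρ * sin (θ s - φh) - B) 1 := by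
    refine ⟨hp₃.1.sub intervalIntegrable_const, fun t ht => ?_⟩
    have e := hp₃.2 t ht
    have e' := intervalIntegral.integral_sub (intervalIntegrable_mono_Icc hp₃.1 m0 ht)
      (intervalIntegrable_const (c := B) (μ := volume) (a := 0) (b := t))
    simp only [intervalIntegral.integral_const, smul_eq_mul] at e e' ⊢
    rw [e']
    linarith
  have b₃ : ∀ s ∈ Icc (0:ℝ) 1, |p₃ s - (p₃ 0 + B * s)| ≤ μ * ρ := fun s hs => by
    have := hq₃.abs_sub_le hsin m0 hs
    simpa using this
  have ilin : ∀ t : ℝ, IntervalIntegrable (fun s => p₃ 0 + B * s) volume 0 t := fun t =>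
    (by fun_prop : Continuous fun s => p₃ 0 + B * s).intervalIntegrable _ _
  have hlin : ∀ t : ℝ, ∫ s in (0:ℝ)..t, (p₃ 0 + B * s) = p₃ 0 * t + B * t ^ 2 / 2 := fun t => by
    rw [intervalIntegral.integral_add intervalIntegrable_const
      ((by fun_prop : Continuous fun s => B * s).intervalIntegrable _ _),
      intervalIntegral.integral_const_mul, integral_id]
    simp only [intervalIntegral.integral_const, smul_eq_mul]
    ring
  have hq₄ : IsPrimitive (fun s => p₄ s - (p₄ 0 + -(p₃ 0) * s + -(B / 2) * s ^ 2))
      (fun s => (-(p₃ s) + deriv φ (κ s)) + (p₃ 0 + B * s)) 1 := by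
    refine ⟨hp₄.1.add (ilin 1), fun t ht => ?_⟩
    have e := hp₄.2 t ht
    have e' := intervalIntegral.integral_add (intervalIntegrable_mono_Icc hp₄.1 m0 ht) (ilin t)
    rw [hlin] at e'
    dsimp only at e e' ⊢
    rw [e', e]
    ring
  refine ⟨B, hsin, b₃, fun s hs => ?_⟩
  have := hq₄.abs_sub_le (C := μ * ρ + μ) (fun t ht => ?_) m0 hs
  · simpa using this
  · have e1 := abs_le.1 (b₃ t ht)
    have e2 := abs_le.1 (hφ' t ht)
    rw [abs_le]
    constructor <;> linarith [e1.1, e1.2, e2.1, e2.2]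

/-- Over a unit time interval with small excess cost the adjoint variables are small. -/
lemma adjoint_small {φ ψ θ κ u p₃ p₄ : ℝ → ℝ} {ρ φh ε μ : ℝ} (h1 : H1 φ ψ)
    (hθ : IsPrimitive θ κ 1)
    (hX : Extremal φ ψ θ κ u 1 ρ φh p₃ p₄) (hκ : ∀ s ∈ Icc (0:ℝ) 1, |κ s| ≤ 18 * ε)
    (hgood : ∀ r s : ℝ, 0 ≤ r → s = r + 1 / 5 → s ≤ 1 → ∀ P : ℝ → Prop,
      (∀ᵐ t, t ∈ Icc (0:ℝ) 1 → P t) → ∃ t ∈ Icc r s, P t ∧ |u t| ≤ ε)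
    (hε : 0 < ε) (hεμ : 18 * ε ≤ μ) (hμ : μ ≤ 1 / 1000)
    (hφ' : ∀ r, |r| ≤ 18 * ε → |deriv φ r| ≤ μ) (hψ' : ∀ r, |r| ≤ ε → |deriv ψ r| ≤ μ)
    (hφμ : ∀ r, |r| ≤ 18 * ε → φ r ≤ μ) (hψμ : ∀ r, |r| ≤ ε → ψ r ≤ μ) :
    ∀ s ∈ Icc (0:ℝ) 1, |p₃ s| ≤ 500 * μ ∧ |p₄ s| ≤ 500 * μ := by
  have hμ0 : 0 < μ := by linarith
  obtain ⟨B, hsin, b₃, b₄⟩ := adjoint_approx hθ hX (fun s hs => (hκ s hs).trans hεμ)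
    (fun s hs => hφ' _ (hκ s hs))
  obtain ⟨hρ, -, -, hst, hham⟩ := hX
  obtain ⟨e, he⟩ : ∃ e, e = 2 * μ + μ * ρ := ⟨_, rfl⟩
  have he0 : 0 ≤ e := by rw [he]; positivity
  have node : ∀ r s : ℝ, 0 ≤ r → s = r + 1 / 5 → s ≤ 1 → ∃ t ∈ Icc r s,
      (deriv ψ (u t) = p₄ t ∧ ρ * cos (θ t - φh) + p₃ t * κ t + p₄ t * u t
        - (1 + φ (κ t) + ψ (u t)) = 0) ∧ |u t| ≤ ε ∧ |p₄ t| ≤ μ ∧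
      |p₄ 0 + -(p₃ 0) * t + -(B / 2) * t ^ 2| ≤ e := fun r s hr hrs hs => by
    obtain ⟨t, ht, hP, hu⟩ := hgood r s hr hrs hs _ (by
      filter_upwards [hst, hham] with t h1 h2 h using And.intro (h1 h) (h2 h))
    have hp : |p₄ t| ≤ μ := hP.1 ▸ hψ' _ hu
    have hb := abs_le.1 (b₄ t ⟨hr.trans ht.1, ht.2.trans hs⟩)
    have hp' := abs_le.1 hp
    refine ⟨t, ht, hP, hu, hp, abs_le.2 ⟨?_, ?_⟩⟩ <;> linarith [hb.1, hb.2, hp'.1, hp'.2]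
  obtain ⟨s₀, hs₀, ⟨-, hH⟩, hu₀, hp₀, hq₀⟩ := node 0 (1 / 5) le_rfl (by norm_num) (by norm_num)
  obtain ⟨s₁, hs₁, -, -, -, hq₁⟩ := node (2 / 5) (3 / 5) (by norm_num) (by norm_num) (by norm_num)
  obtain ⟨s₂, hs₂, -, -, -, hq₂⟩ := node (4 / 5) 1 (by norm_num) (by norm_num) (by norm_num)
  obtain ⟨ha, hb, hc⟩ := abs_quadratic_coeff_le hs₀ hs₁ hs₂ hq₀ hq₁ hq₂
  rw [abs_neg] at hb hc
  have hBe : |B| ≤ 68 * e := by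
    rw [abs_div, abs_two] at hc
    linarith
  have P₃ : ∀ s ∈ Icc (0:ℝ) 1, |p₃ s| ≤ 106 * e + μ * ρ := fun s hs => by
    have f1 := b₃ s hs
    have f2 : |B * s| ≤ 68 * e := by
      rw [abs_mul, abs_of_nonneg hs.1]
      exact (mul_le_of_le_one_right (abs_nonneg _) hs.2).trans hBe
    have f3 := abs_add_le (p₃ s - (p₃ 0 + B * s)) (p₃ 0 + B * s)
    have f4 := abs_add_le (p₃ 0) (B * s)
    rw [sub_add_cancel] at f3
    linarith
  have P₄ : ∀ s ∈ Icc (0:ℝ) 1, |p₄ s| ≤ 83 * e + μ * ρ + μ := fun s hs => by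
    have f1 := b₄ s hs
    have f2 : |-(p₃ 0) * s| ≤ 38 * e := by
      rw [abs_mul, abs_of_nonneg hs.1, abs_neg]
      exact (mul_le_of_le_one_right (abs_nonneg _) hs.2).trans hb
    have f3 : |-(B / 2) * s ^ 2| ≤ 34 * e := by
      rw [abs_mul, abs_of_nonneg (sq_nonneg s), abs_neg]
      exact (mul_le_of_le_one_right (abs_nonneg _) (pow_le_one₀ hs.1 hs.2)).trans hc
    have f4 := abs_add_le (p₄ s - (p₄ 0 + -(p₃ 0) * s + -(B / 2) * s ^ 2))
      (p₄ 0 + -(p₃ 0) * s + -(B / 2) * s ^ 2)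
    have f5 := abs_add_three (p₄ 0) (-(p₃ 0) * s) (-(B / 2) * s ^ 2)
    rw [sub_add_cancel] at f4
    linarith
  have ms : s₀ ∈ Icc (0:ℝ) 1 := ⟨hs₀.1, by linarith [hs₀.2]⟩
  have hμρ : μ * ρ ≤ 1 / 1000 * ρ := mul_le_mul_of_nonneg_right hμ hρ.le
  have hμμ : μ * μ ≤ μ * (1 / 1000) := mul_le_mul_of_nonneg_left hμ hμ0.le
  have hρ2 : ρ ≤ 2 := by
    have g1 : |p₃ s₀ * κ s₀| ≤ (106 * e + μ * ρ) * (1 / 1000) := by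
      rw [abs_mul]
      exact mul_le_mul (P₃ _ ms) (((hκ _ ms).trans hεμ).trans hμ) (abs_nonneg _) (by positivity)
    have g2 : |p₄ s₀ * u s₀| ≤ μ * μ := by
      rw [abs_mul]
      exact mul_le_mul hp₀ (hu₀.trans (by linarith)) (abs_nonneg _) hμ0.le
    have g3 : |ρ * cos (θ s₀ - φh)| ≤ 1 + 2 * μ + (106 * e + μ * ρ) * (1 / 1000) + μ * μ := by
      have m1 := hφμ _ (hκ _ ms)
      have m2 := hψμ _ hu₀
      have m3 := h1.1 (κ s₀)
      have m4 := h1.2.1 (u s₀)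
      have g1' := abs_le.1 g1
      have g2' := abs_le.1 g2
      refine abs_le.2 ⟨?_, ?_⟩ <;> linarith [g1'.1, g1'.2, g2'.1, g2'.2]
    have g4 : |ρ * sin (θ s₀ - φh)| ≤ 68 * e + μ * ρ := by
      have k1 := hsin _ ms
      have k2 := abs_add_le (ρ * sin (θ s₀ - φh) - B) B
      rw [sub_add_cancel] at k2
      linarith
    have g5 := le_abs_mul_cos_add_abs_mul_sin hρ (θ s₀ - φh)
    linarith
  have hμ2 : μ * ρ ≤ μ * 2 := mul_le_mul_of_nonneg_left hρ2 hμ0.le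
  intro s hs
  exact ⟨by linarith [P₃ s hs], by linarith [P₄ s hs]⟩

/-- The excess running cost relative to motion in the direction `γ`. -/
def excess (φ ψ θ κ u : ℝ → ℝ) (γ t : ℝ) : ℝ := 1 + φ (κ t) + ψ (u t) - cos (θ t - γ)

/-- Over a unit time interval with small excess cost, the extended state is close to the
equilibrium in the direction `γ`. -/
lemma exists_excess_threshold {φ ψ : ℝ → ℝ} (h1 : H1 φ ψ) (hc : StrictConvexOn ℝ univ ψ)
    {ν : ℝ} (hν : 0 < ν) : ∃ η > 0, ∀ (θ κ u p₃ p₄ : ℝ → ℝ) (ρ φh γ : ℝ),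
      IsPrimitive θ κ 1 → IsPrimitive κ u 1 → Extremal φ ψ θ κ u 1 ρ φh p₃ p₄ →
      IntervalIntegrable (excess φ ψ θ κ u γ) volume 0 1 →
      ∫ t in (0:ℝ)..1, excess φ ψ θ κ u γ t ≤ η → ∀ s ∈ Icc (0:ℝ) 1,
        1 - cos (θ s - γ) < ν ∧ |κ s| < ν ∧ |p₃ s| < ν ∧ |p₄ s| < ν := by
  have h1' := h1
  obtain ⟨hφ0, hψ0, hφC, hψC, hφe, hψe, hφm, hψm, hφz, hψz⟩ := h1'
  set μ := min (ν / 1000) (1 / 1000) with hμ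
  have hμ0 : 0 < μ := by positivity
  have small : ∀ {f : ℝ → ℝ}, Continuous f → f 0 = 0 → ∃ d > 0, ∀ r, |r| < d → |f r| ≤ μ :=
    fun {f} hf h0 => by
      obtain ⟨d, hd, h⟩ := Metric.continuous_iff.1 hf 0 μ hμ0
      refine ⟨d, hd, fun r hr => ?_⟩
      have := h r (by simpa [dist_eq] using hr)
      rw [h0, dist_zero_right] at this
      exact this.le
  obtain ⟨d1, hd1, k1⟩ := small hφC.continuous hφz
  obtain ⟨d2, hd2, k2⟩ := small hψC.continuous hψz
  obtain ⟨d3, hd3, k3⟩ := small (hφC.continuous_deriv (by norm_num)) (deriv_zero_of_nonneg hφ0 hφz)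
  obtain ⟨d4, hd4, k4⟩ := small (hψC.continuous_deriv (by norm_num)) (deriv_zero_of_nonneg hψ0 hψz)
  set d := min (min (min d1 d2) (min d3 d4)) μ with hd
  have hd0 : 0 < d := by positivity
  have l1 : d ≤ d1 := (min_le_left _ _).trans ((min_le_left _ _).trans (min_le_left _ _))
  have l2 : d ≤ d2 := (min_le_left _ _).trans ((min_le_left _ _).trans (min_le_right _ _))
  have l3 : d ≤ d3 := (min_le_left _ _).trans ((min_le_right _ _).trans (min_le_left _ _))
  have l4 : d ≤ d4 := (min_le_left _ _).trans ((min_le_right _ _).trans (min_le_right _ _))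
  have lμ : d ≤ μ := min_le_right _ _
  have hμν : μ ≤ ν / 1000 := min_le_left _ _
  have hμ1 : μ ≤ 1 / 1000 := min_le_right _ _
  set ε := d / 20 with hε
  have hε0 : 0 < ε := by positivity
  have hψε := strictConvexOn_even_pos hc hψe hψz hε0
  refine ⟨min (ψ ε / 6) (ε ^ 2 / 8), by positivity, ?_⟩
  intro θ κ u p₃ p₄ ρ φh γ hθ hκ hX hE hη
  have hηψ : min (ψ ε / 6) (ε ^ 2 / 8) ≤ ψ ε / 6 := min_le_left _ _
  have hηε : min (ψ ε / 6) (ε ^ 2 / 8) ≤ ε ^ 2 / 8 := min_le_right _ _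
  have hA := small_of_excess_le h1 hc.convexOn hθ hκ hE hη hε0 (by linarith) (by linarith)
    (by linarith) hψε
  have hB := adjoint_small (μ := μ) h1 hθ hX (fun s hs => (hA s hs).1)
    (fun r s hr hrs hs P hP => by
      obtain ⟨t, ht, hPt, hle⟩ := exists_le_of_integral_le (P := P) (r := r) (s := s)
        (η := ψ ε / 6) (by linarith)
        (intervalIntegrable_mono_Icc hE ⟨hr, by linarith⟩ ⟨by linarith, hs⟩)
        ((intervalIntegral.integral_mono_interval hr (by linarith) hs
          (Filter.Eventually.of_forall fun t => by
            have := cos_le_one (θ t - γ)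
            simp only [Pi.zero_apply, excess]
            linarith [hφ0 (κ t), hψ0 (u t)]) hE).trans (hη.trans hηψ))
        (by
          filter_upwards [hP] with t h ht
          exact h ⟨hr.trans ht.1, ht.2.trans hs⟩)
      refine ⟨t, ht, hPt, ?_⟩
      by_contra! hlt
      have h2 := even_monotoneOn_le hψe hψm (r := ε) (R := |u t|)
        (by rw [abs_of_pos hε0]; exact hlt.le)
      have h3 : ψ |u t| = ψ (u t) := by
        rcases abs_choice (u t) with h | h <;> rw [h]
        exact hψe _
      have h4 : s - r = 1 / 5 := by linarith
      rw [h4] at hle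
      unfold excess at hle
      have := cos_le_one (θ t - γ)
      linarith [hφ0 (κ t)])
    hε0 (by linarith) hμ1
    (fun r hr => k3 r (by linarith)) (fun r hr => k4 r (by linarith))
    (fun r hr => (le_abs_self _).trans (k1 r (by linarith)))
    (fun r hr => (le_abs_self _).trans (k2 r (by linarith)))
  intro s hs
  obtain ⟨a1, a2⟩ := hA s hs
  obtain ⟨b1, b2⟩ := hB s hs
  exact ⟨by linarith, by linarith, by linarith, by linarith⟩

lemma exists_angle_shift (x : ℝ) : ∃ k : ℤ, |x - k * (2 * π)| ≤ π := by
  refine ⟨round (x / (2 * π)), ?_⟩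
  have h := abs_sub_round (x / (2 * π))
  have e : x - round (x / (2 * π)) * (2 * π) = (x / (2 * π) - round (x / (2 * π))) * (2 * π) := by
    field_simp
  rw [e, abs_mul, abs_of_pos two_pi_pos]
  nlinarith [pi_pos]

/-- An angle whose cosine is close to one is close to a multiple of `2π`. -/
lemma exists_angle_shift_of_cos {x r : ℝ} (hr : 0 ≤ r) (h : 1 - cos x ≤ 2 / π ^ 2 * r ^ 2) :
    ∃ k : ℤ, |x - k * (2 * π)| ≤ r := by
  obtain ⟨k, hk⟩ := exists_angle_shift x
  refine ⟨k, ?_⟩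
  have h' := cos_le_one_sub_mul_cos_sq hk
  rw [cos_sub_int_mul_two_pi] at h'
  have hπ : 0 < 2 / π ^ 2 := by positivity
  have h2 : 2 / π ^ 2 * (x - k * (2 * π)) ^ 2 ≤ 2 / π ^ 2 * r ^ 2 := by linarith
  exact abs_le_of_sq_le_sq (le_of_mul_le_mul_left h2 hπ) hr

lemma exists_angle_shift_of_cos_lt {x r : ℝ} (hr : 0 < r) (h : 1 - cos x < 2 / π ^ 2 * r ^ 2) :
    ∃ k : ℤ, |x - k * (2 * π)| < r := by
  obtain ⟨k, hk⟩ := exists_angle_shift x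
  refine ⟨k, ?_⟩
  have h' := cos_le_one_sub_mul_cos_sq hk
  rw [cos_sub_int_mul_two_pi] at h'
  have hπ : 0 < 2 / π ^ 2 := by positivity
  have h2 : 2 / π ^ 2 * (x - k * (2 * π)) ^ 2 < 2 / π ^ 2 * r ^ 2 := by linarith
  exact abs_lt_of_sq_lt_sq (lt_of_mul_lt_mul_left h2 hπ.le) hr.le

lemma angleDist_le (a b : ℝ) (k : ℤ) : angleDist a b ≤ |a - b - k * (2 * π)| := by
  have h : ((a - b : ℝ) : Real.Angle) = ((a - b - k * (2 * π) : ℝ) : Real.Angle) :=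
    Real.Angle.angle_eq_iff_two_pi_dvd_sub.2 ⟨k, by ring⟩
  unfold angleDist
  rw [h]
  exact QuotientAddGroup.norm_mk_le_norm

lemma exists_polar (x y : ℝ) : ∃ D β : ℝ, x = D * cos β ∧ y = D * sin β ∧ 0 ≤ D :=
  ⟨‖(⟨x, y⟩ : ℂ)‖, Complex.arg ⟨x, y⟩, (Complex.norm_mul_cos_arg ⟨x, y⟩).symm,
    (Complex.norm_mul_sin_arg ⟨x, y⟩).symm, norm_nonneg _⟩

/-- Among `N` consecutive unit intervals, one carries at most the average. -/
lemma exists_unit_window_le {E : ℝ → ℝ} {T a C η : ℝ} (hE : IntervalIntegrable E volume 0 T)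
    {N : ℕ} (hN : N ≠ 0) (ha : 0 ≤ a) (haN : a + N ≤ T) (hC : ∫ t in a..(a + N), E t ≤ C)
    (hη : C ≤ N * η) : ∃ b, a ≤ b ∧ b + 1 ≤ a + N ∧ ∫ t in b..(b + 1), E t ≤ η := by
  by_contra! hcon
  have hmem : ∀ i ≤ N, a + i ∈ Icc 0 T := fun i hi => by
    have : (i : ℝ) ≤ N := by exact_mod_cast hi
    exact ⟨by positivity, by linarith⟩
  have hsum := intervalIntegral.sum_integral_adjacent_intervals (a := fun i : ℕ => a + i) (f := E)
    (μ := volume) (n := N) fun i hi => intervalIntegrable_mono_Icc hE (hmem i hi.le) (hmem (i + 1) hi)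
  have hlt : ∑ _i ∈ Finset.range N, η <
      ∑ i ∈ Finset.range N, ∫ t in (a + i)..(a + (i + 1 : ℕ)), E t := by
    refine Finset.sum_lt_sum_of_nonempty (Finset.nonempty_range_iff.2 hN) fun i hi => ?_
    have hi' : ((i + 1 : ℕ) : ℝ) ≤ N := by exact_mod_cast Finset.mem_range.1 hi
    push_cast at hi' ⊢
    have := hcon (a + i) (by simp) (by linarith)
    rwa [add_assoc] at this
  rw [hsum] at hlt
  simp only [Finset.sum_const, Finset.card_range, nsmul_eq_mul, Nat.cast_zero, add_zero] at hlt
  linarith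

section Excess

variable {φ ψ : ℝ → ℝ} {p : ℝ} {x y θ κ u p₃ p₄ : ℝ → ℝ} {T ρ φh : ℝ}

lemma one_sub_cos_le_excess (h1 : H1 φ ψ) (γ t : ℝ) :
    1 - cos (θ t - γ) ≤ excess φ ψ θ κ u γ t := by
  have e1 := h1.1 (κ t)
  have e2 := h1.2.1 (u t)
  unfold excess
  linarith

lemma excess_nonneg (h1 : H1 φ ψ) (γ t : ℝ) : 0 ≤ excess φ ψ θ κ u γ t := by
  have e1 := one_sub_cos_le_excess (θ := θ) (κ := κ) (u := u) h1 γ t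
  have e2 := cos_le_one (θ t - γ)
  linarith

lemma Arc.intervalIntegrable_cos (h : Arc φ ψ p x y θ κ u T) (γ : ℝ) :
    IntervalIntegrable (fun t => cos (θ t - γ)) volume 0 T ∧
      ∫ t in (0:ℝ)..T, cos (θ t - γ) = (x T - x 0) * cos γ + (y T - y 0) * sin γ := by
  have mT : T ∈ Icc 0 T := ⟨h.pos.le, le_rfl⟩
  have m0 : (0:ℝ) ∈ Icc 0 T := ⟨le_rfl, h.pos.le⟩
  have ic := h.x_prim.1.mul_const (cos γ)
  have is := h.y_prim.1.mul_const (sin γ)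
  simp only [cos_sub]
  refine ⟨ic.add is, ?_⟩
  rw [intervalIntegral.integral_add ic is, intervalIntegral.integral_mul_const,
    intervalIntegral.integral_mul_const, ← h.x_prim.sub_eq m0 mT, ← h.y_prim.sub_eq m0 mT]

lemma Arc.intervalIntegrable_excess (h : Arc φ ψ p x y θ κ u T) (γ : ℝ) :
    IntervalIntegrable (excess φ ψ θ κ u γ) volume 0 T :=
  h.cost_int.sub (h.intervalIntegrable_cos γ).1

lemma Arc.integral_excess (h : Arc φ ψ p x y θ κ u T) (γ : ℝ) :
    ∫ t in (0:ℝ)..T, excess φ ψ θ κ u γ t =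
      cost φ ψ κ u T - ((x T - x 0) * cos γ + (y T - y 0) * sin γ) := by
  rw [← (h.intervalIntegrable_cos γ).2]
  exact intervalIntegral.integral_sub h.cost_int (h.intervalIntegrable_cos γ).1

lemma Arc.integral_excess_mono (h : Arc φ ψ p x y θ κ u T) (h1 : H1 φ ψ) (γ : ℝ) {a b c d : ℝ}
    (ha : 0 ≤ a) (hac : a ≤ c) (hcd : c ≤ d) (hdb : d ≤ b) (hb : b ≤ T) :
    ∫ t in c..d, excess φ ψ θ κ u γ t ≤ ∫ t in a..b, excess φ ψ θ κ u γ t :=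
  intervalIntegral.integral_mono_interval hac hcd hdb
    (Filter.Eventually.of_forall fun t => excess_nonneg h1 γ t)
    (intervalIntegrable_mono_Icc (h.intervalIntegrable_excess γ) ⟨ha, by linarith⟩
      ⟨by linarith, hb⟩)

/-- An extremal is close to the equilibrium throughout any unit time interval of small excess
cost. -/
lemma exists_window_threshold (h1 : H1 φ ψ) (hc : StrictConvexOn ℝ univ ψ)
    {ν : ℝ} (hν : 0 < ν) : ∃ η > 0, ∀ {p : ℝ} {x y θ κ u p₃ p₄ : ℝ → ℝ} {T ρ φh b : ℝ} (γ : ℝ),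
      Arc φ ψ p x y θ κ u T → Extremal φ ψ θ κ u T ρ φh p₃ p₄ → 0 ≤ b → b + 1 ≤ T →
      ∫ t in b..(b + 1), excess φ ψ θ κ u γ t ≤ η → ∀ t ∈ Icc b (b + 1),
        1 - cos (θ t - γ) < ν ∧ |κ t| < ν ∧ |p₃ t| < ν ∧ |p₄ t| < ν := by
  obtain ⟨η, hη, h⟩ := exists_excess_threshold h1 hc hν
  refine ⟨η, hη, fun {p x y θ κ u p₃ p₄ T ρ φh b} γ hA hX hb hbT hle t ht => ?_⟩
  have hA' := hA.restrict hb one_pos hbT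
  have key := h _ _ _ _ _ ρ φh γ hA'.θ_prim hA'.κ_prim (hX.restrict hb zero_le_one hbT)
    (hA'.intervalIntegrable_excess γ) (by
      have e := intervalIntegral.integral_comp_add_left (a := 0) (b := 1)
        (excess φ ψ θ κ u γ) b
      rw [add_zero] at e
      exact e.le.trans hle) (t - b) ⟨by linarith [ht.1], by linarith [ht.2]⟩
  simpa using key

end Excess

section Optimal

variable {φ ψ : ℝ → ℝ} {p : ℝ} {x y θ κ u p₃ p₄ : ℝ → ℝ} {T ρ φh : ℝ}

/-- An optimal trajectory towards a distant point has bounded excess cost. -/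
lemma IsOptimal.integral_excess_le (h1 : H1 φ ψ) (hp : 0 ≤ p) {x₁ y₁ θ₁ α L : ℝ}
    (hx : x₁ = L * cos α) (hy : y₁ = L * sin α) (hL : 4 ≤ L)
    (hopt : IsOptimal φ ψ p x y θ κ u T Xinit (x₁, y₁, θ₁, 0)) (hA : Arc φ ψ p x y θ κ u T) :
    ∫ t in (0:ℝ)..T, excess φ ψ θ κ u α t ≤ 2 * excessBound φ ψ (20 * (π + π / 6)) := by
  obtain ⟨k, hk⟩ := exists_angle_shift (π / 2 - α)
  obtain ⟨j, hj⟩ := exists_angle_shift (θ₁ - (α + k * (2 * π)))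
  obtain ⟨x', y', θ', κ', u', S, hA', a1, a2, a3, a4, b1, b2, b3, b4, hcost⟩ :=
    exists_arc_of_displacement (p := p) (D := L) (δ := π) (δ₀ := π / 6) (β := α + k * (2 * π))
      (θa := π / 2) (κa := 0) (θb := θ₁ - j * (2 * π)) (κb := 0) h1 hp 0 0 (by positivity) le_rfl
      (by rw [sin_pi_div_six]; linarith) (by rwa [← sub_sub])
      (by rwa [sub_right_comm]) (by simpa using pi_pos.le) (by simpa using pi_pos.le)
  have hC' : Connects p x' y' θ' κ' u' S Xinit (x₁, y₁, θ₁, 0) := by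
    refine hA'.connects (k := -j) (by rw [a1, a2, a3, a4]; rfl) ?_
    rw [b1, b2, b3, b4, cos_add_int_mul_two_pi, sin_add_int_mul_two_pi, ← hx, ← hy]
    push_cast
    ring_nf
  have hle := hopt.2 _ _ _ _ _ _ hC'
  obtain ⟨-, -, -, c1, c2, -, -, -, -, -, -, e1, e2, -, -⟩ := hopt.1
  rw [hA.integral_excess, c1, c2, e1, e2]
  simp only [Xinit]
  have hcs := sin_sq_add_cos_sq α
  have hd : (x₁ - 0) * cos α + (y₁ - 0) * sin α = L := by
    rw [hx, hy]
    linear_combination L * hcs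
  linarith

/-- Between two interior times at which the state is nearly aligned with the displacement, the
excess cost of an optimal trajectory is small. -/
lemma IsOptimal.integral_excess_le_of_aligned (h1 : H1 φ ψ) (hp : 0 ≤ p)
    {W₀ W₁ : ℝ × ℝ × ℝ × ℝ} {a b D β δ : ℝ} {k₁ k₂ : ℤ}
    (hopt : IsOptimal φ ψ p x y θ κ u T W₀ W₁) (hA : Arc φ ψ p x y θ κ u T)
    (ha : 0 < a) (hab : a < b) (hb : b < T) (hx : x b - x a = D * cos β)
    (hy : y b - y a = D * sin β) (hδ : 0 < δ) (hδ' : δ ≤ π / 6) (hD : 2 ≤ D * sin δ)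
    (hθa : |θ a - β - k₁ * (2 * π)| ≤ δ) (hθb : |θ b - β - k₂ * (2 * π)| ≤ δ)
    (hκa : |κ a| ≤ δ) (hκb : |κ b| ≤ δ) :
    ∫ t in a..b, excess φ ψ θ κ u β t ≤ 2 * excessBound φ ψ (20 * (δ + δ)) := by
  obtain ⟨S, rfl⟩ : ∃ S, b = a + S := ⟨b - a, by ring⟩
  have hS : 0 < S := by linarith
  obtain ⟨x', y', θ', κ', u', S', hA', a1, a2, a3, a4, b1, b2, b3, b4, hcost⟩ :=
    exists_arc_of_displacement (p := p) (β := β + k₁ * (2 * π))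
      (θb := θ (a + S) + ((k₁ - k₂ : ℤ) : ℝ) * (2 * π)) h1 hp (x a) (y a) hδ hδ' hD
      (by rwa [← sub_sub]) (by
        convert hθb using 2
        push_cast
        ring) hκa hκb
  rw [cos_add_int_mul_two_pi] at b1
  rw [sin_add_int_mul_two_pi] at b2
  have hle := hopt.cost_le_of_subarc hA ha hS hb hA' a1 a2 a3 a4 (by linarith) (by linarith) b3 b4
  have hI := (hA.restrict ha.le hS hb.le).integral_excess β
  have e := intervalIntegral.integral_comp_add_left (a := 0) (b := S) (excess φ ψ θ κ u β) a
  simp only [add_zero] at e hI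
  rw [← e]
  refine hI.le.trans ?_
  rw [hx, hy]
  have hcs := sin_sq_add_cos_sq β
  have hd : D * cos β * cos β + D * sin β * sin β = D := by linear_combination D * hcs
  linarith

/-- If the excess cost relative to `α` is bounded, then over a long time interval the displacement
is long and its direction is close to `α`. -/
lemma Arc.displacement_of_excess (hA : Arc φ ψ p x y θ κ u T) (h1 : H1 φ ψ) {a b α C D β : ℝ}
    (ha : 0 ≤ a) (hab : a < b) (hb : b ≤ T) (hx : x b - x a = D * cos β)
    (hy : y b - y a = D * sin β) (hD : 0 ≤ D) (hC : ∫ t in a..b, excess φ ψ θ κ u α t ≤ C)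
    (hCab : C < b - a) :
    b - a - C ≤ D ∧ (b - a) * (1 - cos (β - α)) ≤ C := by
  obtain ⟨S, rfl⟩ : ∃ S, b = a + S := ⟨b - a, by ring⟩
  have hS : 0 < S := by linarith
  have hR := hA.restrict ha hS hb
  have e1 := hR.intervalIntegrable_cos α
  have e2 := hR.intervalIntegrable_cos β
  have m1 := intervalIntegral.integral_mono_on (f := fun t => 1 - cos (θ (a + t) - α))
    (g := fun t => excess φ ψ θ κ u α (a + t)) hS.le
    (intervalIntegrable_const.sub e1.1)
    (hR.intervalIntegrable_excess α) (fun t _ => one_sub_cos_le_excess h1 α (a + t))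
  have m2 := intervalIntegral.integral_mono_on (g := fun _ => (1:ℝ)) hS.le e2.1
    intervalIntegrable_const (fun t _ => cos_le_one (θ (a + t) - β))
  have e := intervalIntegral.integral_comp_add_left (a := 0) (b := S) (excess φ ψ θ κ u α) a
  rw [intervalIntegral.integral_sub intervalIntegrable_const e1.1, e, e1.2] at m1
  rw [e2.2] at m2
  simp only [add_zero, intervalIntegral.integral_const, smul_eq_mul, sub_zero, mul_one,
    hx, hy] at m1 m2
  have hcs := sin_sq_add_cos_sq β
  have hd : D * cos β * cos β + D * sin β * sin β = D := by linear_combination D * hcs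
  have hd' : D * cos β * cos α + D * sin β * sin α = D * cos (β - α) := by rw [cos_sub]; ring
  rw [hd] at m2
  rw [hd'] at m1
  rw [add_sub_cancel_left] at *
  have hle1 := mul_le_mul_of_nonneg_left (cos_le_one (β - α)) hD
  refine ⟨by linarith, ?_⟩
  have hpos : 0 ≤ cos (β - α) := by
    by_contra! hneg
    nlinarith
  nlinarith

end Optimal

lemma exists_excessBound_le {φ ψ : ℝ → ℝ} (h1 : H1 φ ψ) {η : ℝ} (hη : 0 < η) :
    ∃ d > 0, ∀ δ, 0 ≤ δ → δ ≤ d → 2 * excessBound φ ψ (20 * (δ + δ)) ≤ η := by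
  obtain ⟨-, -, hφ, hψ, -, -, -, -, hφz, hψz⟩ := h1
  have hcont : Continuous fun δ => 2 * excessBound φ ψ (20 * (δ + δ)) := by
    have := hφ.continuous
    have := hψ.continuous
    unfold excessBound
    fun_prop
  obtain ⟨d, hd, h⟩ := Metric.continuous_iff.1 hcont 0 η hη
  refine ⟨d / 2, by positivity, fun δ h0 hδ => ?_⟩
  have h2 := h δ (by rw [dist_zero_right, norm_eq_abs, abs_of_nonneg h0]; linarith)
  rw [dist_eq] at h2
  simp only [excessBound, add_zero, mul_zero, hφz, hψz] at h2
  have h3 := (le_abs_self _).trans h2.le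
  unfold excessBound
  linarith

/-- On a time interval of length at least one and of small excess cost, an extremal stays close to
the equilibrium. -/
lemma exists_interval_threshold {φ ψ : ℝ → ℝ} (h1 : H1 φ ψ) (hc : StrictConvexOn ℝ univ ψ)
    {ν : ℝ} (hν : 0 < ν) : ∃ η > 0, ∀ {p : ℝ} {x y θ κ u p₃ p₄ : ℝ → ℝ} {T ρ φh a b : ℝ} (γ : ℝ),
      Arc φ ψ p x y θ κ u T → Extremal φ ψ θ κ u T ρ φh p₃ p₄ → 0 ≤ a → a + 1 ≤ b → b ≤ T →
      ∫ t in a..b, excess φ ψ θ κ u γ t ≤ η → ∀ t ∈ Icc a b,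
        1 - cos (θ t - γ) < ν ∧ |κ t| < ν ∧ |p₃ t| < ν ∧ |p₄ t| < ν := by
  obtain ⟨η, hη, h⟩ := exists_window_threshold h1 hc hν
  refine ⟨η, hη, fun {p x y θ κ u p₃ p₄ T ρ φh a b} γ hA hX ha hab hb hle t ht => ?_⟩
  have l1 : a ≤ min t (b - 1) := le_min ht.1 (by linarith)
  have l2 : min t (b - 1) ≤ b - 1 := min_le_right _ _
  refine h γ hA hX (ha.trans l1) (by linarith) ((hA.integral_excess_mono h1 γ ha l1
    (by linarith) (by linarith) hb).trans hle) t ⟨min_le_left _ _, ?_⟩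
  rcases min_choice t (b - 1) with e | e <;> rw [e] <;> linarith [ht.2]

/-- On a long time interval of bounded excess cost there is an interior time at which the state is
close to the equilibrium. -/
lemma exists_good_time {φ ψ : ℝ → ℝ} (h1 : H1 φ ψ) (hc : StrictConvexOn ℝ univ ψ) {r : ℝ}
    (hr : 0 < r) (C : ℝ) : ∃ N : ℕ, N ≠ 0 ∧
      ∀ {p : ℝ} {x y θ κ u p₃ p₄ : ℝ → ℝ} {T ρ φh a : ℝ} (γ : ℝ),
      Arc φ ψ p x y θ κ u T → Extremal φ ψ θ κ u T ρ φh p₃ p₄ → 0 ≤ a → a + N ≤ T →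
      ∫ t in a..(a + N), excess φ ψ θ κ u γ t ≤ C → ∃ t ∈ Ioo a (a + N),
        (∃ k : ℤ, |θ t - γ - k * (2 * π)| < r) ∧ |κ t| < r := by
  have hq : 0 < min r (2 / π ^ 2 * r ^ 2) := lt_min hr (by positivity)
  obtain ⟨η, hη, h⟩ := exists_window_threshold h1 hc hq
  obtain ⟨N, hN⟩ := exists_nat_ge (C / η)
  refine ⟨N + 1, N.succ_ne_zero, fun {p x y θ κ u p₃ p₄ T ρ φh a} γ hA hX ha haT hC => ?_⟩
  have hN' : C ≤ (N + 1 : ℕ) * η := by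
    rw [div_le_iff₀ hη] at hN
    push_cast
    linarith
  obtain ⟨b, hab, hb, hle⟩ := exists_unit_window_le (hA.intervalIntegrable_excess γ)
    N.succ_ne_zero ha haT hC hN'
  obtain ⟨k1, k2, -, -⟩ := h γ hA hX (ha.trans hab) (hb.trans haT) hle (b + 1 / 2)
    ⟨by linarith, by linarith⟩
  exact ⟨b + 1 / 2, ⟨by linarith, by linarith⟩,
    exists_angle_shift_of_cos_lt hr (k1.trans_le (min_le_right _ _)), k2.trans_le (min_le_left _ _)⟩

theorem central_arc_close_to_equilibrium
    (φ ψ : ℝ → ℝ) (p C₀ R₀ : ℝ)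
    (h1 : H1 φ ψ) (h2 : H2 ψ) (h3 : H3 ψ p C₀ R₀)
    (ν : ℝ) (hν : 0 < ν) :
    ∃ τ > (0:ℝ), ∃ σ : ℝ, 2*τ < σ ∧
      ∀ (x₁ y₁ θ₁ α : ℝ), α ∈ Set.Ico 0 (2*π) →
        x₁ = Real.sqrt (x₁^2 + y₁^2) * Real.cos α →
        y₁ = Real.sqrt (x₁^2 + y₁^2) * Real.sin α →
        8 * Real.sqrt π ≤ Real.sqrt (x₁^2 + y₁^2) →
      ∀ (x y θ κ u : ℝ → ℝ) (T ρ φh : ℝ) (p₃ p₄ : ℝ → ℝ),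
        σ < T →
        IsOptimal φ ψ p x y θ κ u T Xinit (x₁, y₁, θ₁, 0) →
        PMPData φ ψ θ κ u T ρ φh p₃ p₄ →
        ∀ t ∈ Set.Icc τ (T - τ),
          angleDist (θ t) α < ν ∧ |κ t| < ν ∧ |p₃ t| < ν ∧ |p₄ t| < ν := by
  have hc := h2.1
  obtain ⟨hp, -, -, -⟩ := h3
  have hp0 : 0 ≤ p := by linarith
  obtain ⟨C, hC⟩ : ∃ C, C = 2 * excessBound φ ψ (20 * (π + π / 6)) := ⟨_, rfl⟩
  have hC0 : 0 ≤ C := by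
    rw [hC]
    unfold excessBound
    linarith [h1.1 (20 * (π + π / 6)), h1.2.1 (20 * (π + π / 6)), sq_nonneg (20 * (π + π / 6))]
  have hν' : 0 < min ν (2 / π ^ 2 * (ν / 2) ^ 2) := lt_min hν (by positivity)
  obtain ⟨η, hη, hclose⟩ := exists_interval_threshold h1 hc hν'
  obtain ⟨d, hd, hbound⟩ := exists_excessBound_le h1 hη
  obtain ⟨δ, hδd, hδπ, hδ⟩ : ∃ δ, δ ≤ d ∧ δ ≤ π / 6 ∧ 0 < δ :=
    ⟨min d (π / 6), min_le_left _ _, min_le_right _ _, lt_min hd (by positivity)⟩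
  obtain ⟨r, hrδ, hrν, hr⟩ : ∃ r, r ≤ δ / 2 ∧ r ≤ ν / 2 ∧ 0 < r :=
    ⟨min (δ / 2) (ν / 2), min_le_left _ _, min_le_right _ _, lt_min (by positivity) (by positivity)⟩
  have hq : 0 < 2 / π ^ 2 * r ^ 2 := by positivity
  have hsin : 0 < sin δ := sin_pos_of_pos_of_lt_pi hδ (by linarith [pi_pos])
  obtain ⟨N, hN, hgood⟩ := exists_good_time h1 hc hr C
  have hN0 : (0:ℝ) < N := by positivity
  obtain ⟨S, hS1, hSsin, hSq⟩ : ∃ S, 1 + C ≤ S ∧ 2 ≤ (S - C) * sin δ ∧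
      C ≤ S * (2 / π ^ 2 * r ^ 2) := by
    have e1 : 0 ≤ 2 / sin δ := by positivity
    have e2 : 0 ≤ C / (2 / π ^ 2 * r ^ 2) := by positivity
    refine ⟨1 + C + 2 / sin δ + C / (2 / π ^ 2 * r ^ 2), by linarith, ?_, ?_⟩
    · rw [← div_le_iff₀ hsin]
      linarith
    · rw [← div_le_iff₀ hq]
      linarith
  refine ⟨N, hN0, 2 * N + S, by linarith, ?_⟩
  intro x₁ y₁ θ₁ α _ hx₁ hy₁ hL x y θ κ u T ρ φh p₃ p₄ hT hopt hP t ht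
  obtain ⟨hA, hX⟩ := hopt.1.arc_and_extremal h1 hc.convexOn hp.le hP
  have hL4 : 4 ≤ √(x₁ ^ 2 + y₁ ^ 2) := by
    have : 1 ≤ √π := one_le_sqrt.2 (by linarith [pi_gt_three])
    linarith
  have htot := hopt.integral_excess_le h1 hp0 hx₁ hy₁ hL4 hA
  rw [← hC] at htot
  have hsub : ∀ {a b : ℝ}, 0 ≤ a → a ≤ b → b ≤ T → ∫ t in a..b, excess φ ψ θ κ u α t ≤ C :=
    fun ha hab hb => (hA.integral_excess_mono h1 α le_rfl ha hab hb le_rfl).trans htot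
  obtain ⟨a, ha, ⟨k₁, hθa⟩, hκa⟩ := hgood α hA hX le_rfl (by linarith)
    (hsub le_rfl (by linarith) (by linarith))
  obtain ⟨b, hb, ⟨k₂, hθb⟩, hκb⟩ := hgood (a := T - N) α hA hX (by linarith) (by linarith)
    (hsub (by linarith) (by linarith) (by linarith))
  rw [zero_add] at ha
  rw [sub_add_cancel] at hb
  have hSab : S < b - a := by linarith [ha.2, hb.1]
  have hab : a < b := by linarith
  obtain ⟨D, β₀, hDx, hDy, hD0⟩ := exists_polar (x b - x a) (y b - y a)
  obtain ⟨hD, hcos⟩ := hA.displacement_of_excess h1 ha.1.le hab hb.2.le hDx hDy hD0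
    (hsub ha.1.le hab.le hb.2.le) (by linarith)
  have hcos' : 1 - cos (β₀ - α) ≤ 2 / π ^ 2 * r ^ 2 :=
    le_of_mul_le_mul_left (hcos.trans (hSq.trans (mul_le_mul_of_nonneg_right hSab.le hq.le)))
      (by linarith : 0 < b - a)
  obtain ⟨k, hk⟩ := exists_angle_shift_of_cos hr.le hcos'
  obtain ⟨β, hβ⟩ : ∃ β, β = β₀ - k * (2 * π) := ⟨_, rfl⟩
  have hβα : |β - α| ≤ r := by rwa [hβ, sub_right_comm]
  have hcβ : cos β = cos β₀ := by rw [hβ, cos_sub_int_mul_two_pi]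
  have hsβ : sin β = sin β₀ := by rw [hβ, sin_sub_int_mul_two_pi]
  rw [← hcβ] at hDx
  rw [← hsβ] at hDy
  have hturn : ∀ {z : ℝ} {j : ℤ}, |z - α - j * (2 * π)| < r → |z - β - j * (2 * π)| ≤ δ :=
    fun {z j} h => by
      rw [show z - β - j * (2 * π) = (z - α - j * (2 * π)) - (β - α) by ring]
      exact (abs_sub _ _).trans (by linarith)
  have hexc := hopt.integral_excess_le_of_aligned h1 hp0 hA ha.1 hab hb.2 hDx hDy hδ hδπ
    (hSsin.trans (mul_le_mul_of_nonneg_right (by linarith) hsin.le)) (hturn hθa) (hturn hθb)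
    (by linarith) (by linarith)
  obtain ⟨c1, c2, c3, c4⟩ := hclose β hA hX ha.1.le (by linarith) hb.2.le
    (hexc.trans (hbound δ hδ.le hδd)) t ⟨by linarith [ht.1, ha.2], by linarith [ht.2, hb.1]⟩
  have lν : min ν (2 / π ^ 2 * (ν / 2) ^ 2) ≤ ν := min_le_left _ _
  refine ⟨?_, c2.trans_le lν, c3.trans_le lν, c4.trans_le lν⟩
  obtain ⟨j, hj⟩ := exists_angle_shift_of_cos_lt (half_pos hν) (c1.trans_le (min_le_right _ _))
  refine (angleDist_le _ _ j).trans_lt ?_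
  rw [show θ t - α - j * (2 * π) = (θ t - β - j * (2 * π)) + (β - α) by ring]
  exact (abs_add_le _ _).trans_lt (by linarith)

end
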